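/- arXiv:1704.08398 — 2 statements merged into one kernel-verified Lean document; each statement's English description precedes it below -/
import Mathlib

section
/- For every positive integer m there exists a constant C(m) > 0 such that for all λ > 0, μ > 0 and every integer n ≥ 1 with 1 ≤ R < n (where R = λ/μ), the m-th moments of the scaled stationary Erlang-C customer count and of its diffusion approximation satisfy |E[(X̃(∞))^m] − E[(Y(∞))^m]| ≤ (1 + 1/|ζ|^{m−1})·C(m)·δ, where δ = 1/√R and ζ = δ(R − n). -/
open MeasureTheory Set

/-- The Mills-type functions. -/
noncomputable def millsG (k : ℕ) (x : ℝ) : ℝ :=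
  ∫ t in Ioi (0:ℝ), t ^ k * Real.exp (x * t - t ^ 2 / 2)

lemma integrable_pow_gauss (k : ℕ) (b : ℝ) (hb : 0 < b) :
    Integrable (fun t : ℝ => t ^ k * Real.exp (-b * t ^ 2)) := by
  have := integrable_rpow_mul_exp_neg_mul_sq hb (s := (k:ℝ)) (by
    have : (0:ℝ) ≤ k := Nat.cast_nonneg k
    linarith)
  simpa using this

lemma mills_integrable (k : ℕ) (x : ℝ) :
    Integrable (fun t : ℝ => t ^ k * Real.exp (x * t - t ^ 2 / 2)) := by
  have h := (integrable_pow_gauss k (1/4) (by norm_num)).norm.const_mul (Real.exp (x ^ 2))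
  refine h.mono' (by fun_prop) ?_
  filter_upwards with t
  rw [norm_mul, norm_mul, Real.norm_of_nonneg (Real.exp_pos _).le,
    Real.norm_of_nonneg (Real.exp_pos _).le]
  have : Real.exp (x * t - t ^ 2 / 2) ≤ Real.exp (x ^ 2) * Real.exp (-(1/4) * t ^ 2) := by
    rw [← Real.exp_add]
    apply Real.exp_le_exp.2
    nlinarith [sq_nonneg (x - t / 2)]
  calc _ ≤ ‖t ^ k‖ * (Real.exp (x ^ 2) * Real.exp (-(1/4) * t ^ 2)) := by gcongr
    _ = _ := by ring

lemma mills_mono (k : ℕ) {x y : ℝ} (h : x ≤ y) : millsG k x ≤ millsG k y := by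
  unfold millsG
  refine setIntegral_mono_on (mills_integrable k x).integrableOn (mills_integrable k y).integrableOn
    measurableSet_Ioi ?_
  intro t ht
  have ht : 0 < t := ht
  gcongr

lemma mills_nonneg (k : ℕ) (x : ℝ) : 0 ≤ millsG k x := by
  refine setIntegral_nonneg measurableSet_Ioi ?_
  intro t ht
  have ht : 0 < t := ht
  positivity

lemma mills_one (x : ℝ) : millsG 1 x = x * millsG 0 x + 1 := by
  have hd : ∀ t ∈ Ici (0:ℝ), HasDerivAt (fun t : ℝ => Real.exp (x * t - t ^ 2 / 2))
      (x * (t ^ 0 * Real.exp (x * t - t ^ 2 / 2)) - t ^ 1 * Real.exp (x * t - t ^ 2 / 2)) t := by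
    intro t _
    have h1 : HasDerivAt (fun t : ℝ => x * t - t ^ 2 / 2) (x - t) t := by
      have := ((hasDerivAt_id t).const_mul x).sub ((hasDerivAt_pow 2 t).div_const 2)
      refine HasDerivAt.congr_deriv this ?_
      simp
    convert h1.exp using 1
    ring
  have hint : IntegrableOn (fun t : ℝ => x * (t ^ 0 * Real.exp (x * t - t ^ 2 / 2))
      - t ^ 1 * Real.exp (x * t - t ^ 2 / 2)) (Ioi 0) :=
    (((mills_integrable 0 x).const_mul x).sub (mills_integrable 1 x)).integrableOn
  have hlim : Filter.Tendsto (fun t : ℝ => Real.exp (x * t - t ^ 2 / 2)) Filter.atTop (nhds 0) := by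
    have := tendsto_zero_of_hasDerivAt_of_integrableOn_Ioi (a := 0) 
      (fun t ht => hd t (le_of_lt (mem_Ioi.1 ht))) hint (by simpa using (mills_integrable 0 x).integrableOn)
    exact this
  have := integral_Ioi_of_hasDerivAt_of_tendsto' hd hint hlim
  rw [integral_sub ((mills_integrable 0 x).const_mul x).integrableOn
    (mills_integrable 1 x).integrableOn, integral_const_mul] at this
  simp only [mul_zero, ne_eq, OfNat.ofNat_ne_zero, not_false_eq_true, zero_pow, zero_div, sub_zero,
    Real.exp_zero] at this
  unfold millsG
  linarith

lemma mills_diff (x δ : ℝ) (hδ : 0 < δ) :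
    millsG 1 x ≤ (millsG 0 (x + δ) - millsG 0 x) / δ ∧
    (millsG 0 (x + δ) - millsG 0 x) / δ ≤ millsG 1 x + δ * millsG 2 (x + δ) := by
  have e : ∀ t : ℝ, Real.exp ((x + δ) * t - t ^ 2 / 2)
      = Real.exp (x * t - t ^ 2 / 2) * Real.exp (δ * t) := by
    intro t; rw [← Real.exp_add]; ring_nf
  constructor
  · rw [le_div_iff₀ hδ, mul_comm]
    unfold millsG
    rw [← integral_sub (mills_integrable 0 (x+δ)).integrableOn (mills_integrable 0 x).integrableOn,
      ← integral_const_mul]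
    refine setIntegral_mono_on ((mills_integrable 1 x).const_mul _).integrableOn
      ((mills_integrable 0 (x+δ)).sub (mills_integrable 0 x)).integrableOn measurableSet_Ioi ?_
    intro t ht
    rw [e]
    have := Real.add_one_le_exp (δ * t)
    have h2 := Real.exp_pos (x * t - t ^ 2 / 2)
    nlinarith
  · rw [div_le_iff₀ hδ]
    unfold millsG
    have i1 := ((mills_integrable 1 x).const_mul δ)
    have i2 := ((mills_integrable 2 (x+δ)).const_mul (δ^2))
    rw [← integral_sub (mills_integrable 0 (x+δ)).integrableOn (mills_integrable 0 x).integrableOn]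
    have : ((∫ t in Ioi (0:ℝ), t ^ 1 * Real.exp (x * t - t ^ 2 / 2)) +
        δ * ∫ t in Ioi (0:ℝ), t ^ 2 * Real.exp ((x + δ) * t - t ^ 2 / 2)) * δ
        = ∫ t in Ioi (0:ℝ), (δ * (t ^ 1 * Real.exp (x * t - t ^ 2 / 2)) +
          δ ^ 2 * (t ^ 2 * Real.exp ((x + δ) * t - t ^ 2 / 2))) := by
      rw [integral_add i1.integrableOn i2.integrableOn, integral_const_mul, integral_const_mul]
      ring
    rw [this]
    refine setIntegral_mono_on 
      ((mills_integrable 0 (x+δ)).sub (mills_integrable 0 x)).integrableOn 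
      (i1.add i2).integrableOn measurableSet_Ioi ?_
    intro t ht
    have ht : 0 < t := ht
    rw [e]
    have hs : 0 < δ * t := by positivity
    set s := δ * t with hsd
    have key : Real.exp s - 1 ≤ s + s ^ 2 * Real.exp s := by
      have h1 := Real.add_one_le_exp (-s)
      have h3 : Real.exp (-s) * Real.exp s = 1 := by rw [← Real.exp_add]; simp
      have h4 := Real.exp_pos s
      -- (1 - s) e^s ≤ 1
      have h5 : (1 - s) * Real.exp s ≤ 1 := by nlinarith
      nlinarith
    have h2 := Real.exp_pos (x * t - t ^ 2 / 2)
    have e2 : δ * (t ^ 1 * Real.exp (x * t - t ^ 2 / 2)) +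
          δ ^ 2 * (t ^ 2 * (Real.exp (x * t - t ^ 2 / 2) * Real.exp s))
          = Real.exp (x * t - t ^ 2 / 2) * (s + s ^ 2 * Real.exp s) := by
      rw [hsd]; ring
    rw [e2]
    nlinarith

lemma mills_upper : ∃ K : ℝ, 0 < K ∧ ∀ y : ℝ,
    millsG 2 y ≤ K * (1 + y ^ 2) * Real.exp (y ^ 2 / 2) := by
  have i0 : Integrable (fun s : ℝ => Real.exp (-(1/2) * s ^ 2)) := by
    simpa using integrable_pow_gauss 0 (1/2) (by norm_num)
  have i2 := integrable_pow_gauss 2 (1/2) (by norm_num)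
  set c0 := ∫ s : ℝ, Real.exp (-(1/2) * s ^ 2)
  set c2 := ∫ s : ℝ, s ^ 2 * Real.exp (-(1/2) * s ^ 2)
  have h0 : 0 ≤ c0 := integral_nonneg (fun s => (Real.exp_pos _).le)
  have h2 : 0 ≤ c2 := integral_nonneg (fun s => by positivity)
  refine ⟨2 * c2 + 2 * c0 + 1, by positivity, fun y => ?_⟩
  have hi : Integrable (fun s : ℝ => Real.exp (y ^ 2 / 2) * (2 * (s ^ 2 * Real.exp (-(1/2) * s ^ 2))
      + 2 * y ^ 2 * Real.exp (-(1/2) * s ^ 2))) :=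
    ((i2.const_mul 2).add (i0.const_mul (2 * y ^ 2))).const_mul _
  have e : ∫ s : ℝ, Real.exp (y ^ 2 / 2) * (2 * (s ^ 2 * Real.exp (-(1/2) * s ^ 2))
      + 2 * y ^ 2 * Real.exp (-(1/2) * s ^ 2)) = Real.exp (y ^ 2 / 2) * (2 * c2 + 2 * y ^ 2 * c0) := by
    rw [integral_const_mul, integral_add (i2.const_mul 2) (i0.const_mul (2 * y ^ 2)),
      integral_const_mul, integral_const_mul]
  have hm : millsG 2 y ≤ ∫ t : ℝ, (fun s : ℝ => Real.exp (y ^ 2 / 2) *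
      (2 * (s ^ 2 * Real.exp (-(1/2) * s ^ 2))
      + 2 * y ^ 2 * Real.exp (-(1/2) * s ^ 2))) (t - y) := by
    unfold millsG
    refine (setIntegral_le_integral (mills_integrable 2 y) ?_).trans ?_
    · filter_upwards with t
      simp only [Pi.zero_apply]; positivity
    · refine integral_mono (mills_integrable 2 y) (hi.comp_sub_right y) ?_
      intro t
      simp only
      have : Real.exp (y * t - t ^ 2 / 2) = Real.exp (y ^ 2 / 2) * Real.exp (-(1/2) * (t - y) ^ 2) := by
        rw [← Real.exp_add]; ring_nf
      rw [this]
      have hp : 0 < Real.exp (y ^ 2 / 2) * Real.exp (-(1/2) * (t - y) ^ 2) := by positivity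
      nlinarith [sq_nonneg (t - 2 * y)]
  have e' := integral_sub_right_eq_self (μ := (volume : Measure ℝ)) (fun s : ℝ => Real.exp (y ^ 2 / 2) *
      (2 * (s ^ 2 * Real.exp (-(1/2) * s ^ 2))
      + 2 * y ^ 2 * Real.exp (-(1/2) * s ^ 2))) y
  rw [e', e] at hm
  refine hm.trans ?_
  have := Real.exp_pos (y ^ 2 / 2)
  have : 2 * c2 + 2 * y ^ 2 * c0 ≤ (2 * c2 + 2 * c0 + 1) * (1 + y ^ 2) := by
    nlinarith [sq_nonneg y, mul_nonneg (sq_nonneg y) h2]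
  nlinarith

lemma mills_lower (a : ℝ) (ha : 0 ≤ a) :
    Real.exp (-(1/2)) * Real.exp (a ^ 2 / 2) ≤ millsG 0 a := by
  unfold millsG
  have h1 : ∫ t in Ioc a (a+1), (Real.exp (-(1/2)) * Real.exp (a ^ 2 / 2)) ≤
      ∫ t in Ioc a (a+1), t ^ 0 * Real.exp (a * t - t ^ 2 / 2) := by
    refine setIntegral_mono_on (integrableOn_const (by simp)) (mills_integrable 0 a).integrableOn measurableSet_Ioc ?_
    intro t ht
    rw [← Real.exp_add, pow_zero, one_mul]
    apply Real.exp_le_exp.2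
    nlinarith [ht.1, ht.2]
  have h2 : ∫ t in Ioc a (a+1), t ^ 0 * Real.exp (a * t - t ^ 2 / 2) ≤
     ∫ t in Ioi (0:ℝ), t ^ 0 * Real.exp (a * t - t ^ 2 / 2) := by
    refine setIntegral_mono_set (mills_integrable 0 a).integrableOn ?_ ?_
    · filter_upwards with t
      simp only [Pi.zero_apply]; positivity
    · apply LE.le.eventuallyLE
      intro t ht
      exact lt_of_le_of_lt ha ht.1
  refine le_trans ?_ (h1.trans h2)
  simp

lemma pow_exp_bound (k : ℕ) : ∃ C : ℝ, 0 < C ∧ ∀ s : ℝ, 0 ≤ s → (1 + s) ^ k ≤ C * Real.exp (s / 2) := by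
  refine ⟨(2 ^ k * k.factorial) * Real.exp (1/2), by positivity, fun s hs => ?_⟩
  have := Real.pow_div_factorial_le_exp ((1 + s) / 2) (by positivity) k
  rw [div_le_iff₀ (by positivity), div_pow, div_le_iff₀ (by positivity)] at this
  refine this.trans (le_of_eq ?_)
  rw [add_div, Real.exp_add]; ring

lemma mills_ratio (k : ℕ) : ∃ C : ℝ, 0 < C ∧ ∀ a y : ℝ, 0 ≤ a → y ≤ a →
    millsG 2 y * (1 + a ^ 2) ^ k ≤ C * millsG 0 a * (1 + y ^ 2) ^ (k + 1) := by
  obtain ⟨K, hK, hU⟩ := mills_upper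
  obtain ⟨P, hP, hB⟩ := pow_exp_bound k
  -- first for nonneg arguments
  have main : ∀ a y : ℝ, 0 ≤ y → y ≤ a →
      millsG 2 y * (1 + a ^ 2) ^ k ≤ K * P * Real.exp (1/2) * millsG 0 a * (1 + y ^ 2) ^ (k + 1) := by
    intro a y hy hya
    have hs : 0 ≤ a ^ 2 - y ^ 2 := by nlinarith
    have h1 := hB _ hs
    have h2 : (1 + a ^ 2) ^ k ≤ (1 + y ^ 2) ^ k * (1 + (a ^ 2 - y ^ 2)) ^ k := by
      rw [← mul_pow]
      gcongr
      nlinarith [mul_nonneg hs (sq_nonneg y)]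
    have h3 := mills_lower a (hy.trans hya)
    have h4 : Real.exp (y ^ 2 / 2) * Real.exp ((a ^ 2 - y ^ 2) / 2) = 
        Real.exp (1/2) * (Real.exp (-(1/2)) * Real.exp (a ^ 2 / 2)) := by
      rw [← Real.exp_add, ← Real.exp_add, ← Real.exp_add]; ring_nf
    calc millsG 2 y * (1 + a ^ 2) ^ k 
        ≤ (K * (1 + y ^ 2) * Real.exp (y ^ 2 / 2)) * 
          ((1 + y ^ 2) ^ k * (P * Real.exp ((a ^ 2 - y ^ 2) / 2))) := by
          refine mul_le_mul (hU y) (h2.trans ?_) (by positivity) (by positivity)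
          gcongr
      _ = K * P * (1 + y ^ 2) ^ (k+1) * (Real.exp (y ^ 2 / 2) * Real.exp ((a ^ 2 - y ^ 2) / 2)) := by
          ring
      _ ≤ K * P * (1 + y ^ 2) ^ (k+1) * (Real.exp (1/2) * millsG 0 a) := by
          rw [h4]; gcongr
      _ = _ := by ring
  refine ⟨K * P * Real.exp (1/2), by positivity, fun a y ha hy => ?_⟩
  rcases le_total 0 y with h | h
  · exact main a y h hy
  · have h1 := main a 0 le_rfl ha
    have h2 := mills_mono 2 h
    have h3 := mills_nonneg 0 a
    calc millsG 2 y * (1 + a ^ 2) ^ k ≤ millsG 2 0 * (1 + a ^ 2) ^ k := by gcongr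
      _ ≤ _ := h1
      _ ≤ _ := by
        gcongr K * P * Real.exp (1/2) * millsG 0 a * ?_
        gcongr ?_ ^ _
        nlinarith [sq_nonneg y]

/-- Lower part of the discrete distribution with its Stein identity. -/
structure LowerPart (n : ℕ) (w x : ℕ → ℝ) (a δ p : ℝ) : Prop where
  a_pos : 0 < a
  δ_pos : 0 < δ
  δ_le : δ ≤ 1
  w_nonneg : ∀ k, 0 ≤ w k
  p_nonneg : 0 ≤ p
  total : ∑ k ∈ Finset.range n, w k + p = 1
  x_le : ∀ k ∈ Finset.range n, x k + δ ≤ a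
  stein : ∀ g : ℝ → ℝ, ∑ k ∈ Finset.range n, w k * ((g (x k + δ) - g (x k)) / δ - x k * g (x k))
    = a * p * g a

lemma diff_pow (x δ : ℝ) (hδ : δ ≠ 0) (j : ℕ) :
    ((x + δ) ^ (j + 1) - x ^ (j + 1)) / δ =
      ∑ i ∈ Finset.range (j + 1), ((j + 1).choose i : ℝ) * δ ^ (j - i) * x ^ i := by
  rw [div_eq_iff hδ, add_pow, Finset.sum_range_succ]
  simp only [Nat.sub_self, pow_zero, mul_one, Nat.choose_self, Nat.cast_one, add_sub_cancel_right]
  rw [Finset.sum_mul]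
  refine Finset.sum_congr rfl fun i hi => ?_
  have : j + 1 - i = (j - i) + 1 := by
    have := Finset.mem_range.1 hi
    omega
  rw [this, pow_succ]; ring

lemma abs_pow_le_one_add (x : ℝ) (i k : ℕ) (h : i ≤ 2 * k) : |x| ^ i ≤ 1 + x ^ (2 * k) := by
  have e : x ^ (2 * k) = |x| ^ (2 * k) := by rw [pow_mul, pow_mul, sq_abs]
  rw [e]
  rcases le_total |x| 1 with h1 | h1
  · have := pow_le_one₀ (n := i) (abs_nonneg x) h1
    have : 0 ≤ |x| ^ (2 * k) := by positivity
    linarith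
  · have := pow_le_pow_right₀ h1 h
    linarith

lemma lower_even (k : ℕ) : ∃ C : ℝ, 0 < C ∧ ∀ n w x a δ p, LowerPart n w x a δ p →
    ∑ i ∈ Finset.range n, w i * x i ^ (2 * k) + p * a ^ (2 * k) ≤ C := by
  induction k with
  | zero =>
    refine ⟨1, one_pos, fun n w x a δ p h => ?_⟩
    simpa using h.total.le
  | succ k ih =>
    obtain ⟨C, hC, ih⟩ := ih
    set S : ℝ := ∑ i ∈ Finset.range (2 * k + 1), ((2 * k + 1).choose i : ℝ)
    have hS : 0 ≤ S := by positivity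
    refine ⟨S * (1 + C) + 1, by positivity, fun n w x a δ p h => ?_⟩
    have h1 := ih n w x a δ p h
    have hst := h.stein (fun y => y ^ (2 * k + 1))
    simp only [diff_pow _ _ h.δ_pos.ne', mul_sub, Finset.sum_sub_distrib] at hst
    have h2 : ∑ i ∈ Finset.range n, w i * (x i * x i ^ (2 * k + 1)) 
        = ∑ i ∈ Finset.range n, w i * x i ^ (2 * (k + 1)) :=
      Finset.sum_congr rfl fun i _ => by ring
    have h3 : a * p * a ^ (2 * k + 1) = p * a ^ (2 * (k+1)) := by ring
    rw [h2, h3] at hst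
    have h4 : ∑ l ∈ Finset.range n, w l * ∑ i ∈ Finset.range (2 * k + 1),
        ((2 * k + 1).choose i : ℝ) * δ ^ (2 * k - i) * x l ^ i ≤
        ∑ l ∈ Finset.range n, w l * (S * (1 + x l ^ (2 * k))) := by
      refine Finset.sum_le_sum fun l _ => mul_le_mul_of_nonneg_left ?_ (h.w_nonneg l)
      rw [Finset.sum_mul]
      refine Finset.sum_le_sum fun i hi => ?_
      have hi' := Finset.mem_range.1 hi
      rw [mul_assoc]
      refine mul_le_mul_of_nonneg_left ?_ (by positivity)
      have b1 := abs_pow_le_one_add (x l) i k (by omega)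
      have b2 : δ ^ (2 * k - i) ≤ 1 := pow_le_one₀ h.δ_pos.le h.δ_le
      have b3 : 0 ≤ δ ^ (2 * k - i) := pow_nonneg h.δ_pos.le _
      calc δ ^ (2 * k - i) * x l ^ i ≤ |δ ^ (2 * k - i) * x l ^ i| := le_abs_self _
        _ = δ ^ (2 * k - i) * |x l| ^ i := by rw [abs_mul, abs_of_nonneg b3, abs_pow]
        _ ≤ 1 * |x l| ^ i := by gcongr
        _ ≤ _ := by linarith
    have h5 : ∑ l ∈ Finset.range n, w l * (S * (1 + x l ^ (2 * k))) = 
        S * (∑ l ∈ Finset.range n, w l + ∑ l ∈ Finset.range n, w l * x l ^ (2 * k)) := by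
      rw [← Finset.sum_add_distrib, Finset.mul_sum]
      exact Finset.sum_congr rfl fun i _ => by ring
    have h6 : 0 ≤ p * a ^ (2 * k) := mul_nonneg h.p_nonneg (pow_nonneg h.a_pos.le _)
    have h7 : S * (∑ l ∈ Finset.range n, w l + ∑ l ∈ Finset.range n, w l * x l ^ (2 * k)) ≤ S * (1 + C) := by
      refine mul_le_mul_of_nonneg_left ?_ hS
      linarith [h.total, h.p_nonneg]
    linarith

lemma lower_abs (k : ℕ) : ∃ C : ℝ, 0 < C ∧ ∀ n w x a δ p, LowerPart n w x a δ p →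
    ∑ i ∈ Finset.range n, w i * |x i| ^ k ≤ C ∧ p * a ^ k ≤ C := by
  obtain ⟨C, hC, h⟩ := lower_even k
  refine ⟨1 + C, by positivity, fun n w x a δ p hl => ?_⟩
  have h1 := h n w x a δ p hl
  have n1 : 0 ≤ ∑ i ∈ Finset.range n, w i * x i ^ (2 * k) :=
    Finset.sum_nonneg fun i _ => mul_nonneg (hl.w_nonneg i) (by rw [pow_mul]; positivity)
  have n2 : 0 ≤ p * a ^ (2 * k) := mul_nonneg hl.p_nonneg (pow_nonneg hl.a_pos.le _)
  have n3 : 0 ≤ ∑ i ∈ Finset.range n, w i := Finset.sum_nonneg fun i _ => hl.w_nonneg i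
  have ht := hl.total
  have hp := hl.p_nonneg
  constructor
  · calc ∑ i ∈ Finset.range n, w i * |x i| ^ k 
        ≤ ∑ i ∈ Finset.range n, w i * (1 + x i ^ (2 * k)) := 
        Finset.sum_le_sum fun i _ => mul_le_mul_of_nonneg_left 
          (abs_pow_le_one_add _ _ _ (by omega)) (hl.w_nonneg i)
      _ = ∑ i ∈ Finset.range n, w i + ∑ i ∈ Finset.range n, w i * x i ^ (2 * k) := by
        rw [← Finset.sum_add_distrib]; exact Finset.sum_congr rfl fun i _ => by ring
      _ ≤ _ := by linarith
  · have := abs_pow_le_one_add a k k (by omega)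
    rw [abs_of_pos hl.a_pos] at this
    nlinarith

lemma lower_d (k : ℕ) : ∃ C : ℝ, 0 < C ∧ ∀ n w x a δ p, LowerPart n w x a δ p →
    ∀ q : ℝ, q * (1 + a * millsG 0 a) = 1 → |p - q| * a ^ k ≤ C * δ * min a 1 := by
  obtain ⟨C1, hC1, hr⟩ := mills_ratio k
  obtain ⟨C2, hC2, hm⟩ := lower_even (k + 1)
  set K1 := millsG 2 1 * millsG 0 1 with hK1
  have hK1n : 0 ≤ K1 := mul_nonneg (mills_nonneg 2 1) (mills_nonneg 0 1)
  set K2 : ℝ := C1 * (2 ^ k * (3 ^ (k+1) + 2 ^ (k+1) * C2)) with hK2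
  have hK2n : 0 < K2 := by positivity
  refine ⟨K1 + K2, by positivity, fun n w x a δ p h q hq => ?_⟩
  have ha := h.a_pos
  have hδ := h.δ_pos
  have hG : 0 < millsG 0 a := lt_of_lt_of_le (by positivity) (mills_lower a ha.le)
  set ε := ∑ i ∈ Finset.range n, w i * ((millsG 0 (x i + δ) - millsG 0 (x i)) / δ - millsG 1 (x i))
    with hε
  have hε0 : 0 ≤ ε := Finset.sum_nonneg fun i _ => mul_nonneg (h.w_nonneg i) 
    (by linarith [(mills_diff (x i) δ hδ).1])
  have hε1 : ε ≤ δ * ∑ i ∈ Finset.range n, w i * millsG 2 (x i + δ) := by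
    rw [Finset.mul_sum]
    refine Finset.sum_le_sum fun i _ => ?_
    have := mul_le_mul_of_nonneg_left (a := w i) 
      (sub_le_iff_le_add'.2 (mills_diff (x i) δ hδ).2) (h.w_nonneg i)
    linarith
  have hp : p * (1 + a * millsG 0 a) = 1 + ε := by
    have hst := h.stein (millsG 0)
    have : ∑ i ∈ Finset.range n, w i * ((millsG 0 (x i + δ) - millsG 0 (x i)) / δ - x i * millsG 0 (x i))
      = ε + ∑ i ∈ Finset.range n, w i := by
      rw [hε, ← Finset.sum_add_distrib]
      refine Finset.sum_congr rfl fun i _ => ?_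
      rw [mills_one]; ring
    linarith [h.total]
  have hd : (p - q) * (1 + a * millsG 0 a) = ε := by linarith
  have hpos : 0 < 1 + a * millsG 0 a := by positivity
  have hd0 : 0 ≤ p - q := by
    by_contra hc
    push Not at hc
    nlinarith
  rw [abs_of_nonneg hd0]
  rcases le_total a 1 with h1 | h1
  · rw [min_eq_left h1]
    have s1 : ∑ i ∈ Finset.range n, w i * millsG 2 (x i + δ) ≤ millsG 2 1 * ∑ i ∈ Finset.range n, w i := by
      rw [Finset.mul_sum]
      refine Finset.sum_le_sum fun i hi => ?_
      rw [mul_comm]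
      exact mul_le_mul_of_nonneg_right (mills_mono 2 ((h.x_le i hi).trans h1)) (h.w_nonneg i)
    have hp1 : p ≤ 1 := by
      have := Finset.sum_nonneg (s := Finset.range n) fun i _ => h.w_nonneg i
      linarith [h.total]
    have s2 : ∑ i ∈ Finset.range n, w i ≤ a * millsG 0 1 := by
      have e : ∑ i ∈ Finset.range n, w i = p * (a * millsG 0 a) - ε := by linarith [h.total]
      have b : p * (a * millsG 0 a) ≤ 1 * (a * millsG 0 1) := by
        have := mills_mono 0 h1
        gcongr
      linarith
    have s3 : p - q ≤ ε := by
      have : 0 ≤ (p - q) * (a * millsG 0 a) := by positivity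
      linarith
    have hak : a ^ k ≤ 1 := pow_le_one₀ ha.le h1
    calc (p - q) * a ^ k ≤ (p - q) * 1 := by gcongr
      _ ≤ δ * (millsG 2 1 * (a * millsG 0 1)) := by
        rw [mul_one]
        refine s3.trans (hε1.trans ?_)
        have := mills_nonneg 2 1
        refine mul_le_mul_of_nonneg_left (s1.trans ?_) hδ.le
        gcongr
      _ = K1 * δ * a := by rw [hK1]; ring
      _ ≤ (K1 + K2) * δ * a := by gcongr; linarith
  · rw [min_eq_right h1]
    have s1 : (∑ i ∈ Finset.range n, w i * millsG 2 (x i + δ)) * (1 + a ^ 2) ^ k ≤ K2 * millsG 0 a := by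
      have t1 : (∑ i ∈ Finset.range n, w i * millsG 2 (x i + δ)) * (1 + a ^ 2) ^ k ≤ 
          ∑ i ∈ Finset.range n, w i * (C1 * millsG 0 a * 
            (2 ^ k * (3 ^ (k+1) + 2 ^ (k+1) * x i ^ (2 * (k + 1))))) := by
        rw [Finset.sum_mul]
        refine Finset.sum_le_sum fun i hi => ?_
        rw [mul_assoc]
        refine mul_le_mul_of_nonneg_left ((hr a _ ha.le (h.x_le i hi)).trans ?_) (h.w_nonneg i)
        refine mul_le_mul_of_nonneg_left ?_ (by positivity)
        calc (1 + (x i + δ) ^ 2) ^ (k+1) ≤ (3 + 2 * x i ^ 2) ^ (k+1) := by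
              gcongr ?_ ^ _
              nlinarith [sq_nonneg (x i - δ), h.δ_le]
          _ ≤ 2 ^ (k + 1 - 1) * (3 ^ (k+1) + (2 * x i ^ 2) ^ (k+1)) := 
              add_pow_le (by norm_num) (by positivity) _
          _ = _ := by rw [mul_pow, ← pow_mul]; simp
      have t2 : ∑ i ∈ Finset.range n, w i * (C1 * millsG 0 a * 
            (2 ^ k * (3 ^ (k+1) + 2 ^ (k+1) * x i ^ (2 * (k + 1))))) = 
          C1 * millsG 0 a * 2 ^ k * (3 ^ (k+1) * ∑ i ∈ Finset.range n, w i + 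
            2 ^ (k+1) * ∑ i ∈ Finset.range n, w i * x i ^ (2 * (k + 1))) := by
        rw [Finset.mul_sum, Finset.mul_sum, ← Finset.sum_add_distrib, Finset.mul_sum]
        exact Finset.sum_congr rfl fun i _ => by ring
      have t3 : ∑ i ∈ Finset.range n, w i ≤ 1 := by linarith [h.total, h.p_nonneg]
      have t4 : ∑ i ∈ Finset.range n, w i * x i ^ (2 * (k + 1)) ≤ C2 := by
        have := hm n w x a δ p h
        have : 0 ≤ p * a ^ (2 * (k + 1)) := mul_nonneg h.p_nonneg (by positivity)
        linarith
      calc _ ≤ _ := t1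
        _ = _ := t2
        _ ≤ C1 * millsG 0 a * 2 ^ k * (3 ^ (k+1) * 1 + 2 ^ (k+1) * C2) := by gcongr
        _ = _ := by rw [hK2]; ring
    have s2 : (p - q) * a ^ k * millsG 0 a ≤ K2 * δ * millsG 0 a := by
      have u1 : a ^ k ≤ (1 + a ^ 2) ^ k := by
        gcongr; nlinarith
      have u2 : millsG 0 a ≤ 1 + a * millsG 0 a := by nlinarith
      calc (p - q) * a ^ k * millsG 0 a ≤ (p - q) * (1 + a ^ 2) ^ k * (1 + a * millsG 0 a) := by gcongr
        _ = ε * (1 + a ^ 2) ^ k := by rw [← hd]; ring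
        _ ≤ (δ * ∑ i ∈ Finset.range n, w i * millsG 2 (x i + δ)) * (1 + a ^ 2) ^ k := by gcongr
        _ = δ * ((∑ i ∈ Finset.range n, w i * millsG 2 (x i + δ)) * (1 + a ^ 2) ^ k) := by ring
        _ ≤ δ * (K2 * millsG 0 a) := by gcongr
        _ = _ := by ring
    have s3 := le_of_mul_le_mul_right s2 hG
    nlinarith

lemma lower_err (j : ℕ) : ∃ C : ℝ, 0 < C ∧ ∀ n w x a δ p, LowerPart n w x a δ p →
    ∀ q : ℝ, q * (1 + a * millsG 0 a) = 1 → ∀ N : ℕ → ℝ, N 0 = 1 - q → N 1 = - (a * q) →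
      (∀ j, N (j + 2) = (j + 1) * N j - a ^ (j + 2) * q) →
      |∑ i ∈ Finset.range n, w i * x i ^ j - N j| ≤ C * δ := by
  induction j using Nat.strong_induction_on with
  | _ j ih =>
    match j, ih with
    | 0, _ =>
      obtain ⟨C, hC, hd⟩ := lower_d 0
      refine ⟨C, hC, fun n w x a δ p h q hq N h0 _ _ => ?_⟩
      have := hd n w x a δ p h q hq
      rw [h0]
      have e : ∑ i ∈ Finset.range n, w i * x i ^ 0 - (1 - q) = -(p - q) := by
        simp; linarith [h.total]
      rw [e, abs_neg]
      have hδ := h.δ_pos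
      calc |p - q| ≤ C * δ * min a 1 := by simpa using this
        _ ≤ C * δ * 1 := by gcongr; exact min_le_right _ _
        _ = _ := by ring
    | 1, _ =>
      obtain ⟨C, hC, hd⟩ := lower_d 1
      refine ⟨C, hC, fun n w x a δ p h q hq N _ h1 _ => ?_⟩
      have := hd n w x a δ p h q hq
      have hst := h.stein (fun _ => 1)
      simp at hst
      have e : ∑ i ∈ Finset.range n, w i * x i ^ 1 - N 1 = -((p - q) * a) := by
        rw [h1]; simp; linarith
      have hδ := h.δ_pos
      rw [e, abs_neg, abs_mul, abs_of_pos h.a_pos]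
      calc |p - q| * a ≤ C * δ * min a 1 := by simpa using this
        _ ≤ C * δ * 1 := by gcongr; exact min_le_right _ _
        _ = _ := by ring
    | j + 2, ih =>
      obtain ⟨C, hC, hd⟩ := lower_d (j + 2)
      obtain ⟨C', hC', ih⟩ := ih j (by omega)
      choose A hA hAb using lower_abs
      set S : ℝ := ∑ i ∈ Finset.range j, ((j + 1).choose i : ℝ) * A i with hS
      have hSn : 0 ≤ S := Finset.sum_nonneg fun i _ => mul_nonneg (by positivity) (hA i).le
      refine ⟨C + (j + 1) * C' + S, by positivity, fun n w x a δ p h q hq N h0 h1 h2 => ?_⟩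
      have b1 := hd n w x a δ p h q hq
      have b2 := ih n w x a δ p h q hq N h0 h1 h2
      have hδ := h.δ_pos
      have hst := h.stein (fun y => y ^ (j + 1))
      simp only [diff_pow _ _ h.δ_pos.ne', mul_sub, Finset.sum_sub_distrib] at hst
      have e1 : ∑ i ∈ Finset.range n, w i * (x i * x i ^ (j + 1)) 
          = ∑ i ∈ Finset.range n, w i * x i ^ (j + 2) :=
        Finset.sum_congr rfl fun i _ => by ring
      have e2 : ∑ l ∈ Finset.range n, w l * ∑ i ∈ Finset.range (j + 1),
          ((j + 1).choose i : ℝ) * δ ^ (j - i) * x l ^ i = 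
          (j + 1) * ∑ l ∈ Finset.range n, w l * x l ^ j + 
          ∑ i ∈ Finset.range j, ((j + 1).choose i : ℝ) * δ ^ (j - i) * 
            ∑ l ∈ Finset.range n, w l * x l ^ i := by
        simp only [Finset.mul_sum]
        rw [Finset.sum_comm, Finset.sum_range_succ, add_comm]
        congr 1
        · refine Finset.sum_congr rfl fun l _ => ?_
          simp
          ring
        · refine Finset.sum_congr rfl fun i _ => Finset.sum_congr rfl fun l _ => ?_
          ring
      rw [e1, e2] at hst
      set T := ∑ i ∈ Finset.range j, ((j + 1).choose i : ℝ) * δ ^ (j - i) * 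
            ∑ l ∈ Finset.range n, w l * x l ^ i with hT
      have bT : |T| ≤ S * δ := by
        rw [hT, hS, Finset.sum_mul]
        refine (Finset.abs_sum_le_sum_abs _ _).trans (Finset.sum_le_sum fun i hi => ?_)
        have hi' := Finset.mem_range.1 hi
        have c1 : |∑ l ∈ Finset.range n, w l * x l ^ i| ≤ A i := by
          refine (Finset.abs_sum_le_sum_abs _ _).trans (le_trans (le_of_eq ?_) (hAb i n w x a δ p h).1)
          refine Finset.sum_congr rfl fun l _ => ?_
          rw [abs_mul, abs_pow, abs_of_nonneg (h.w_nonneg l)]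
        have c2 : δ ^ (j - i) ≤ δ := pow_le_of_le_one hδ.le h.δ_le (by omega)
        rw [abs_mul, abs_mul, abs_of_nonneg (by positivity : (0:ℝ) ≤ ((j + 1).choose i : ℝ)),
          abs_of_nonneg (by positivity : 0 ≤ δ ^ (j - i))]
        calc ((j + 1).choose i : ℝ) * δ ^ (j - i) * |∑ l ∈ Finset.range n, w l * x l ^ i| 
            ≤ ((j + 1).choose i : ℝ) * δ * A i := by gcongr
          _ = _ := by ring
      have e3 : ∑ i ∈ Finset.range n, w i * x i ^ (j + 2) - N (j + 2) = 
          (j + 1) * (∑ i ∈ Finset.range n, w i * x i ^ j - N j) + T - (p - q) * a ^ (j + 2) := by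
        rw [h2]; linear_combination -hst
      rw [e3]
      have b3 : |(p - q) * a ^ (j + 2)| ≤ C * δ := by
        rw [abs_mul, abs_of_pos (pow_pos h.a_pos _)]
        calc _ ≤ C * δ * min a 1 := b1
          _ ≤ C * δ * 1 := by gcongr; exact min_le_right _ _
          _ = _ := by ring
      have b4 : |((j:ℝ) + 1) * (∑ i ∈ Finset.range n, w i * x i ^ j - N j)| ≤ (j + 1) * (C' * δ) := by
        rw [abs_mul, abs_of_nonneg (by positivity : (0:ℝ) ≤ (j:ℝ) + 1)]
        gcongr
      calc _ ≤ |((j:ℝ) + 1) * (∑ i ∈ Finset.range n, w i * x i ^ j - N j)| + |T| + |(p - q) * a ^ (j + 2)| :=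
            (abs_sub _ _).trans (by gcongr; exact abs_add_le _ _)
        _ ≤ (j + 1) * (C' * δ) + S * δ + C * δ := by gcongr
        _ = _ := by ring

/-- Upper-part recursion. -/
structure UpperPart (U : ℕ → ℝ) (a δ p : ℝ) : Prop where
  zero : U 0 = p
  nonneg : ∀ j, 0 ≤ U j
  recur : ∀ j, a * U (j + 1) = a ^ (j + 2) * p + 
    ∑ i ∈ Finset.range (j + 1), ((j + 1).choose i : ℝ) * δ ^ (j - i) * U i

lemma upper_bound (j : ℕ) : ∃ C : ℝ, 0 < C ∧ ∀ n w x a δ p, LowerPart n w x a δ p →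
    ∀ U, UpperPart U a δ p → U j * min a 1 ^ j ≤ C := by
  induction j using Nat.strong_induction_on with
  | _ j ih =>
    match j, ih with
    | 0, _ =>
      refine ⟨1, one_pos, fun n w x a δ p h U hU => ?_⟩
      have := Finset.sum_nonneg (s := Finset.range n) fun i _ => h.w_nonneg i
      simp [hU.zero]
      linarith [h.total]
    | j + 1, ih =>
      choose! B hB hBb using ih
      obtain ⟨A, hA, hAb⟩ := lower_abs (j + 1)
      set S : ℝ := ∑ i ∈ Finset.range (j + 1), ((j + 1).choose i : ℝ) * B i with hS
      have hSn : 0 ≤ S := Finset.sum_nonneg fun i hi => mul_nonneg (by positivity) 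
        (hB i (Finset.mem_range.1 hi)).le
      refine ⟨A + S, by positivity, fun n w x a δ p h U hU => ?_⟩
      have ha := h.a_pos
      have hδ := h.δ_pos
      have hp := h.p_nonneg
      set r := min a 1 with hr
      have hr0 : 0 < r := lt_min ha one_pos
      have hr1 : r ≤ 1 := min_le_right _ _
      have hra : r ≤ a := min_le_left _ _
      have b1 := (hAb n w x a δ p h).2
      refine le_of_mul_le_mul_left ?_ ha
      have e : a * (U (j + 1) * r ^ (j + 1)) = a * (p * a ^ (j + 1)) * r ^ (j + 1) + 
          r * ∑ i ∈ Finset.range (j + 1), ((j + 1).choose i : ℝ) * δ ^ (j - i) * U i * r ^ j := by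
        rw [← mul_assoc, hU.recur, ← Finset.sum_mul]; ring
      rw [e]
      have b2 : ∑ i ∈ Finset.range (j + 1), ((j + 1).choose i : ℝ) * δ ^ (j - i) * U i * r ^ j ≤ S := by
        refine Finset.sum_le_sum fun i hi => ?_
        have hi' := Finset.mem_range.1 hi
        have c1 := hBb i hi' n w x a δ p h U hU
        have c2 : δ ^ (j - i) ≤ 1 := pow_le_one₀ hδ.le h.δ_le
        have c3 : r ^ j ≤ r ^ i := pow_le_pow_of_le_one hr0.le hr1 (by omega)
        have c4 := hU.nonneg i
        calc ((j + 1).choose i : ℝ) * δ ^ (j - i) * U i * r ^ j 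
            ≤ ((j + 1).choose i : ℝ) * 1 * U i * r ^ i := by gcongr
          _ = ((j + 1).choose i : ℝ) * (U i * r ^ i) := by ring
          _ ≤ _ := by gcongr
      have b3 : r ^ (j + 1) ≤ 1 := pow_le_one₀ hr0.le hr1
      have b4 : r * ∑ i ∈ Finset.range (j + 1), ((j + 1).choose i : ℝ) * δ ^ (j - i) * U i * r ^ j ≤
          a * S := (mul_le_mul_of_nonneg_left b2 hr0.le).trans (mul_le_mul_of_nonneg_right hra hSn)
      calc _ ≤ a * A * 1 + a * S := by gcongr
        _ = _ := by ring

lemma upper_err (j : ℕ) : ∃ C : ℝ, 0 < C ∧ ∀ n w x a δ p, LowerPart n w x a δ p →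
    ∀ U, UpperPart U a δ p → ∀ q : ℝ, q * (1 + a * millsG 0 a) = 1 → 
    ∀ V : ℕ → ℝ, V 0 = q → (∀ j, a * V (j + 1) = a ^ (j + 2) * q + (j + 1) * V j) →
     |U j - V j| * min a 1 ^ j ≤ C * δ * min a 1 := by
  induction j with
  | zero =>
    obtain ⟨C, hC, hd⟩ := lower_d 0
    refine ⟨C, hC, fun n w x a δ p h U hU q hq V h0 _ => ?_⟩
    rw [hU.zero, h0]
    simpa using hd n w x a δ p h q hq
  | succ j ih =>
    obtain ⟨C, hC, hd⟩ := lower_d (j + 1)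
    obtain ⟨C', hC', ih⟩ := ih
    choose B hB hBb using upper_bound
    set S : ℝ := ∑ i ∈ Finset.range j, ((j + 1).choose i : ℝ) * B i with hS
    have hSn : 0 ≤ S := Finset.sum_nonneg fun i hi => mul_nonneg (by positivity) (hB i).le
    refine ⟨C + (j + 1) * C' + S, by positivity, fun n w x a δ p h U hU q hq V h0 h1 => ?_⟩
    have ha := h.a_pos
    have hδ := h.δ_pos
    have b1 := hd n w x a δ p h q hq
    have b2 := ih n w x a δ p h U hU q hq V h0 h1
    set r := min a 1 with hr
    have hr0 : 0 < r := lt_min ha one_pos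
    have hr1 : r ≤ 1 := min_le_right _ _
    have hra : r ≤ a := min_le_left _ _
    set T := ∑ i ∈ Finset.range j, ((j + 1).choose i : ℝ) * δ ^ (j - i) * U i with hT
    have hTn : 0 ≤ T := Finset.sum_nonneg fun i hi => mul_nonneg (by positivity) (hU.nonneg i)
    have bT : T * r ^ j ≤ S * δ * r := by
      rw [hT, hS, Finset.sum_mul, Finset.sum_mul, Finset.sum_mul]
      refine Finset.sum_le_sum fun i hi => ?_
      have hi' := Finset.mem_range.1 hi
      have c1 := hBb i n w x a δ p h U hU
      have c2 : δ ^ (j - i) ≤ δ := pow_le_of_le_one hδ.le h.δ_le (by omega)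
      have c3 : r ^ j ≤ r ^ (i + 1) := pow_le_pow_of_le_one hr0.le hr1 (by omega)
      have c4 := hU.nonneg i
      calc ((j + 1).choose i : ℝ) * δ ^ (j - i) * U i * r ^ j 
          ≤ ((j + 1).choose i : ℝ) * δ * U i * r ^ (i + 1) := by gcongr
        _ = ((j + 1).choose i : ℝ) * (U i * r ^ i) * δ * r := by ring
        _ ≤ _ := by gcongr
    have e : a * (U (j + 1) - V (j + 1)) = a * ((p - q) * a ^ (j + 1)) + (j + 1) * (U j - V j) + T := by
      have := hU.recur j
      rw [Finset.sum_range_succ] at this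
      simp at this
      rw [mul_sub, h1, this]; ring
    have e2 : a * |U (j + 1) - V (j + 1)| ≤ a * (|p - q| * a ^ (j + 1)) + (j + 1) * |U j - V j| + T := by
      calc a * |U (j + 1) - V (j + 1)| = |a * (U (j + 1) - V (j + 1))| := by
            rw [abs_mul, abs_of_pos ha]
        _ ≤ |a * ((p - q) * a ^ (j + 1))| + |((j:ℝ) + 1) * (U j - V j)| + |T| := by
          rw [e]; exact abs_add_three _ _ _
        _ = _ := by
          rw [abs_mul, abs_mul, abs_mul, abs_of_pos ha, abs_of_pos (pow_pos ha _), abs_of_nonneg hTn,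
            abs_of_nonneg (by positivity : (0:ℝ) ≤ (j:ℝ) + 1)]
    refine le_of_mul_le_mul_left ?_ ha
    have b3 : r ^ (j + 1) ≤ 1 := pow_le_one₀ hr0.le hr1
    calc a * (|U (j + 1) - V (j + 1)| * r ^ (j + 1)) = a * |U (j + 1) - V (j + 1)| * r ^ (j + 1) := by ring
      _ ≤ (a * (|p - q| * a ^ (j + 1)) + (j + 1) * |U j - V j| + T) * r ^ (j + 1) := by gcongr
      _ = a * (|p - q| * a ^ (j + 1)) * r ^ (j + 1) + r * ((j + 1) * (|U j - V j| * r ^ j) + T * r ^ j) := by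
        ring
      _ ≤ a * (C * δ * r) * 1 + a * ((j + 1) * (C' * δ * r) + S * δ * r) := by gcongr
      _ = _ := by ring

lemma gauss_integrable (j : ℕ) : Integrable (fun x : ℝ => x ^ j * Real.exp (-x ^ 2 / 2)) := by
  refine (integrable_pow_gauss j (1/2) (by norm_num)).congr ?_
  filter_upwards with x
  congr 2; ring

lemma gauss_deriv (j : ℕ) (x : ℝ) : HasDerivAt (fun x : ℝ => x ^ j * Real.exp (-x ^ 2 / 2))
    (j * (x ^ (j - 1) * Real.exp (-x ^ 2 / 2)) - x ^ (j + 1) * Real.exp (-x ^ 2 / 2)) x := by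
  have h1 : HasDerivAt (fun t : ℝ => -t ^ 2 / 2) (-x) x := by
    have := ((hasDerivAt_pow 2 x).neg.div_const 2)
    refine HasDerivAt.congr_deriv this ?_
    simp
    ring
  refine HasDerivAt.congr_deriv ((hasDerivAt_pow j x).mul h1.exp) ?_
  ring

lemma gauss_rec (a : ℝ) (j : ℕ) : 
    j * (∫ x in Iic a, x ^ (j - 1) * Real.exp (-x ^ 2 / 2)) -
      (∫ x in Iic a, x ^ (j + 1) * Real.exp (-x ^ 2 / 2)) = a ^ j * Real.exp (-a ^ 2 / 2) := by
  have hint : IntegrableOn (fun x : ℝ => j * (x ^ (j - 1) * Real.exp (-x ^ 2 / 2)) - 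
      x ^ (j + 1) * Real.exp (-x ^ 2 / 2)) (Iic a) :=
    (((gauss_integrable _).const_mul _).sub (gauss_integrable _)).integrableOn
  have hlim := tendsto_zero_of_hasDerivAt_of_integrableOn_Iic (a := a) 
    (fun x _ => gauss_deriv j x) hint (gauss_integrable j).integrableOn
  have := integral_Iic_of_hasDerivAt_of_tendsto' (fun x _ => gauss_deriv j x) hint hlim
  rw [integral_sub ((gauss_integrable _).const_mul _).integrableOn
    (gauss_integrable _).integrableOn, integral_const_mul] at this
  linarith

lemma gauss_zero (a : ℝ) : 
    ∫ x in Iic a, x ^ 0 * Real.exp (-x ^ 2 / 2) = Real.exp (-a ^ 2 / 2) * millsG 0 a := by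
  unfold millsG
  rw [← integral_const_mul, ← integral_indicator measurableSet_Iic, 
    ← integral_sub_left_eq_self _ volume a, ← integral_Ici_eq_integral_Ioi, 
    ← integral_indicator measurableSet_Ici]
  congr 1
  ext t
  by_cases h : 0 ≤ t
  · rw [indicator_of_mem (by simpa using h), indicator_of_mem (by simpa using h)]
    simp only [pow_zero, one_mul]
    rw [← Real.exp_add]; ring_nf
  · rw [indicator_of_notMem (by simpa using h), indicator_of_notMem (by simpa using h)]

lemma expo_integrable (a : ℝ) (ha : 0 < a) (j : ℕ) : 
    IntegrableOn (fun x : ℝ => x ^ j * Real.exp (-(a * x))) (Ioi a) := by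
  have := integrableOn_rpow_mul_exp_neg_mul_rpow (s := (j:ℝ)) (p := 1) (b := a) (by
    have : (0:ℝ) ≤ j := Nat.cast_nonneg j
    linarith) one_pos ha
  refine (this.mono_set (Ioi_subset_Ioi ha.le)).congr_fun ?_ measurableSet_Ioi
  intro x _
  simp

lemma expo_deriv (a : ℝ) (j : ℕ) (x : ℝ) : HasDerivAt (fun x : ℝ => x ^ j * Real.exp (-(a * x)))
    (j * (x ^ (j - 1) * Real.exp (-(a * x))) - a * (x ^ j * Real.exp (-(a * x)))) x := by
  have h1 : HasDerivAt (fun t : ℝ => -(a * t)) (-a) x := by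
    have := ((hasDerivAt_id x).const_mul a).neg
    refine HasDerivAt.congr_deriv this ?_
    simp
  refine HasDerivAt.congr_deriv ((hasDerivAt_pow j x).mul h1.exp) ?_
  ring

lemma expo_rec (a : ℝ) (ha : 0 < a) (j : ℕ) :
    a * (∫ x in Ioi a, x ^ j * Real.exp (-(a * x))) = 
      j * (∫ x in Ioi a, x ^ (j - 1) * Real.exp (-(a * x))) + a ^ j * Real.exp (-(a * a)) := by
  have i1 := (expo_integrable a ha (j - 1)).const_mul (j : ℝ)
  have i2 := (expo_integrable a ha j).const_mul a
  have hlim := tendsto_zero_of_hasDerivAt_of_integrableOn_Ioi (a := a) 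
    (fun x _ => expo_deriv a j x) (i1.sub i2) (expo_integrable a ha j)
  have := integral_Ioi_of_hasDerivAt_of_tendsto' (fun x _ => expo_deriv a j x) (i1.sub i2) hlim
  rw [integral_sub i1 i2, integral_const_mul, integral_const_mul] at this
  linarith

lemma cont_part (a κ : ℝ) (ha : 0 < a) (ν : ℝ → ℝ)
    (h1 : ∀ x, x ≤ a → ν x = κ * Real.exp (-x ^ 2 / 2))
    (h2 : ∀ x, a < x → ν x = κ * Real.exp (a ^ 2 / 2 - a * x))
    (hν : ∫ x, ν x = 1) :
    ∃ (q : ℝ) (N V : ℕ → ℝ), q * (1 + a * millsG 0 a) = 1 ∧ N 0 = 1 - q ∧ N 1 = -(a * q) ∧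
      (∀ j : ℕ, N (j + 2) = (j + 1) * N j - a ^ (j + 2) * q) ∧ V 0 = q ∧
      (∀ j : ℕ, a * V (j + 1) = a ^ (j + 2) * q + (j + 1) * V j) ∧
      ∀ j : ℕ, ∫ x, x ^ j * ν x = N j + V j := by
  have l1 : ∀ j : ℕ, IntegrableOn (fun x => x ^ j * ν x) (Iic a) ∧ 
      ∫ x in Iic a, x ^ j * ν x = κ * ∫ x in Iic a, x ^ j * Real.exp (-x ^ 2 / 2) := by
    intro j
    have e : EqOn (fun x => κ * (x ^ j * Real.exp (-x ^ 2 / 2))) (fun x => x ^ j * ν x) (Iic a) := by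
      intro x hx
      simp only
      rw [h1 x hx]; ring
    constructor
    · exact (((gauss_integrable j).const_mul κ).integrableOn).congr_fun e measurableSet_Iic
    · rw [← integral_const_mul]
      exact (setIntegral_congr_fun measurableSet_Iic e).symm
  have l2 : ∀ j : ℕ, IntegrableOn (fun x => x ^ j * ν x) (Ioi a) ∧ 
      ∫ x in Ioi a, x ^ j * ν x = κ * Real.exp (a ^ 2 / 2) * 
        ∫ x in Ioi a, x ^ j * Real.exp (-(a * x)) := by
    intro j
    have e : EqOn (fun x => κ * Real.exp (a ^ 2 / 2) * (x ^ j * Real.exp (-(a * x)))) 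
        (fun x => x ^ j * ν x) (Ioi a) := by
      intro x hx
      simp only
      rw [h2 x hx, sub_eq_add_neg, Real.exp_add]; ring
    constructor
    · exact IntegrableOn.congr_fun ((expo_integrable a ha j).const_mul _) e measurableSet_Ioi
    · rw [← integral_const_mul]
      exact (setIntegral_congr_fun measurableSet_Ioi e).symm
  have l3 : ∀ j : ℕ, ∫ x, x ^ j * ν x = (∫ x in Iic a, x ^ j * ν x) + ∫ x in Ioi a, x ^ j * ν x := by
    intro j
    have hi : Integrable (fun x => x ^ j * ν x) := by
      rw [← integrableOn_univ, ← Iic_union_Ioi (a := a)]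
      exact (l1 j).1.union (l2 j).1
    rw [← integral_add_compl (measurableSet_Iic (a := a)) hi, compl_Iic]
  set q := ∫ x in Ioi a, x ^ 0 * ν x with hq
  have hexp : Real.exp (a ^ 2 / 2) * Real.exp (-(a * a)) = Real.exp (-a ^ 2 / 2) := by
    rw [← Real.exp_add]; ring_nf
  have hqk : κ * Real.exp (-a ^ 2 / 2) = a * q := by
    rw [hq, (l2 0).2]
    have := expo_rec a ha 0
    simp only [Nat.cast_zero, zero_mul, zero_add, pow_zero, one_mul] at this
    simp only [pow_zero, one_mul]
    rw [← hexp]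
    linear_combination (-κ * Real.exp (a ^ 2 / 2)) * this
  have h0 : (∫ x in Iic a, x ^ 0 * ν x) = 1 - q := by
    have := l3 0
    simp only [pow_zero, one_mul] at this hq ⊢
    rw [hν] at this
    linarith
  refine ⟨q, fun j => ∫ x in Iic a, x ^ j * ν x, fun j => ∫ x in Ioi a, x ^ j * ν x, ?_, h0, ?_, ?_, 
    rfl, ?_, l3⟩
  · rw [(l1 0).2, gauss_zero] at h0
    linear_combination h0 - millsG 0 a * hqk
  · have := gauss_rec a 0
    simp only [Nat.cast_zero, zero_mul, zero_sub, pow_zero, one_mul, zero_add] at this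
    simp only
    rw [(l1 1).2]
    linear_combination (-κ) * this - hqk
  · intro j
    have := gauss_rec a (j + 1)
    simp only [Nat.add_sub_cancel, Nat.cast_add, Nat.cast_one] at this
    simp only
    rw [(l1 (j+2)).2, (l1 j).2]
    linear_combination (-κ) * this - a ^ (j + 1) * hqk
  · intro j
    have := expo_rec a ha (j + 1)
    simp only [Nat.add_sub_cancel, Nat.cast_add, Nat.cast_one] at this
    simp only
    rw [(l2 (j+1)).2, (l2 j).2]
    linear_combination (κ * Real.exp (a ^ 2 / 2)) * this + a ^ (j + 1) * hqk + κ * a ^ (j + 1) * hexp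

lemma disc_part (n : ℕ) (R δ a : ℝ) (hR : 1 ≤ R) (hRn : R < n) (hδ : δ = 1 / Real.sqrt R)
    (ha : a = δ * (n - R)) (pi : ℕ → ℝ) (hpi : ∀ k, 0 ≤ pi k) (hsum : ∑' k, pi k = 1)
    (hrec : ∀ k : ℕ, R * pi k = min ((k:ℝ) + 1) n * pi (k + 1)) :
    ∃ (p : ℝ) (U : ℕ → ℝ), LowerPart n pi (fun k => δ * (k - R)) a δ p ∧ UpperPart U a δ p ∧
      ∀ j : ℕ, ∑' k : ℕ, pi k * (δ * ((k:ℝ) - R)) ^ j = 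
        ∑ k ∈ Finset.range n, pi k * (δ * ((k:ℝ) - R)) ^ j + U j := by
  have hR0 : 0 < R := by linarith
  have hs1 : 1 ≤ Real.sqrt R := by rw [← Real.sqrt_one]; exact Real.sqrt_le_sqrt hR
  have hδ0 : 0 < δ := by rw [hδ]; positivity
  have hδ1 : δ ≤ 1 := by rw [hδ, div_le_one (by linarith)]; exact hs1
  have hδR : δ * δ * R = 1 := by
    rw [hδ]
    have := Real.mul_self_sqrt hR0.le
    field_simp
    rw [sq]; exact this.symm
  have hn0 : (0:ℝ) < n := by linarith
  have ha0 : 0 < a := by rw [ha]; exact mul_pos hδ0 (by linarith)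
  -- tail
  have htail : ∀ i : ℕ, R * pi (i + n) = n * pi (i + 1 + n) := by
    intro i
    have := hrec (i + n)
    rw [min_eq_right (by push_cast; have : (0:ℝ) ≤ i := Nat.cast_nonneg i; linarith)] at this
    rw [this]; congr 2; omega
  have hgeo : ∀ i : ℕ, pi (i + n) = pi n * (R / n) ^ i := by
    intro i
    induction i with
    | zero => simp
    | succ i ih =>
      have := htail i
      rw [ih] at this
      rw [pow_succ]
      field_simp
      linarith
  set X : ℕ → ℝ := fun i => δ * (((i + n : ℕ) : ℝ) - R) with hX
  have hXa : ∀ i, X i = a + δ * i := by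
    intro i; simp only [hX, ha]; push_cast; ring
  have hXs : ∀ i, X (i + 1) = X i + δ := by
    intro i; rw [hXa, hXa]; push_cast; ring
  have hSum : ∀ j : ℕ, Summable (fun i => pi (i + n) * X i ^ j) := by
    intro j
    have e : (fun i => pi (i + n) * X i ^ j) = fun i : ℕ => ∑ l ∈ Finset.range (j + 1), 
        pi n * (a ^ l * δ ^ (j - l) * (j.choose l)) * ((i:ℝ) ^ (j - l) * (R / n) ^ i) := by
      ext i
      rw [hgeo, hXa, add_pow, Finset.mul_sum]
      refine Finset.sum_congr rfl fun l _ => ?_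
      rw [mul_pow]; ring
    rw [e]
    refine summable_sum fun l _ => Summable.mul_left _ ?_
    refine summable_pow_mul_geometric_of_norm_lt_one _ ?_
    rw [Real.norm_of_nonneg (by positivity), div_lt_one hn0]
    exact hRn
  set U : ℕ → ℝ := fun j => ∑' i, pi (i + n) * X i ^ j with hU
  have hshift : ∀ j : ℕ, R * ∑' i, pi (i + n) * (X i + δ) ^ j = n * (U j - pi n * a ^ j) := by
    intro j
    have h1 := (hSum j).sum_add_tsum_nat_add 1
    have h2 : ∑ i ∈ Finset.range 1, pi (i + n) * X i ^ j = pi n * a ^ j := by simp [hXa]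
    rw [h2] at h1
    have : U j - pi n * a ^ j = ∑' i, pi (i + 1 + n) * X (i + 1) ^ j := by
      simp only [hU]; linarith
    rw [this, ← tsum_mul_left, ← tsum_mul_left]
    refine tsum_congr fun i => ?_
    rw [← mul_assoc, htail, hXs]; ring
  set p := U 0 with hp
  have hap : a * p = δ * n * pi n := by
    have := hshift 0
    simp only [pow_zero, mul_one] at this
    have e : ∑' i, pi (i + n) = p := by simp [hp, hU]
    rw [e, ← hp] at this
    rw [ha]; linear_combination (-δ) * this
  have hUn : ∀ j, 0 ≤ U j := fun j => tsum_nonneg fun i => mul_nonneg (hpi _) 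
    (pow_nonneg (by rw [hXa]; positivity) _)
  have hall : ∀ j : ℕ, ∑' k : ℕ, pi k * (δ * ((k:ℝ) - R)) ^ j = 
        ∑ k ∈ Finset.range n, pi k * (δ * ((k:ℝ) - R)) ^ j + U j := by
    intro j
    have : Summable (fun k : ℕ => pi k * (δ * ((k:ℝ) - R)) ^ j) := by
      rw [← summable_nat_add_iff n]
      exact hSum j
    exact (this.sum_add_tsum_nat_add n).symm
  refine ⟨p, U, ⟨ha0, hδ0, hδ1, hpi, hUn 0, ?_, ?_, ?_⟩, ⟨rfl, hUn, ?_⟩, hall⟩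
  · have := hall 0
    simp only [pow_zero, mul_one, hsum] at this
    exact this.symm
  · intro k hk
    have hk := Finset.mem_range.1 hk
    have : (k:ℝ) + 1 ≤ n := by exact_mod_cast hk
    rw [ha]; nlinarith
  · intro g
    have : ∀ k ∈ Finset.range n, pi k * ((g (δ * (k - R) + δ) - g (δ * (k - R))) / δ - 
        δ * (k - R) * g (δ * (k - R))) = 
        (fun k : ℕ => δ * (k * pi k * g (δ * (k - R)))) (k + 1) - 
        (fun k : ℕ => δ * (k * pi k * g (δ * (k - R)))) k := by
      intro k hk
      have hk := Finset.mem_range.1 hk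
      have h1 : (k:ℝ) + 1 ≤ n := by exact_mod_cast hk
      have h2 := hrec k
      rw [min_eq_left h1] at h2
      have e : δ * (((k + 1 : ℕ):ℝ) - R) = δ * (k - R) + δ := by push_cast; ring
      have hinv : δ⁻¹ = δ * R := by
        exact inv_eq_of_mul_eq_one_right (by linear_combination hδR)
      simp only [e, div_eq_mul_inv, hinv]
      push_cast
      linear_combination δ * g (δ * (k - R) + δ) * h2
    rw [Finset.sum_congr rfl this, Finset.sum_range_sub (fun k : ℕ => δ * (k * pi k * g (δ * (k - R)))),
      hap, ha]
    simp; ring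
  · intro j
    have h1 := hshift (j + 1)
    have e : ∑' i, pi (i + n) * (X i + δ) ^ (j + 1) = U (j + 1) + 
        δ * ∑ l ∈ Finset.range (j + 1), ((j + 1).choose l : ℝ) * δ ^ (j - l) * U l := by
      have t1 : ∀ i, pi (i + n) * (X i + δ) ^ (j + 1) = pi (i + n) * X i ^ (j + 1) + 
          ∑ l ∈ Finset.range (j + 1), δ * (((j + 1).choose l : ℝ) * δ ^ (j - l)) * (pi (i + n) * X i ^ l) := by
        intro i
        have := diff_pow (X i) δ hδ0.ne' j
        rw [div_eq_iff hδ0.ne', sub_eq_iff_eq_add] at this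
        rw [this, mul_add, add_comm, Finset.sum_mul, Finset.mul_sum]
        congr 1
        exact Finset.sum_congr rfl fun l _ => by ring
      rw [tsum_congr t1, Summable.tsum_add (hSum _) (summable_sum fun l _ => (hSum l).mul_left _),
        Summable.tsum_finsetSum (fun l _ => (hSum l).mul_left _), Finset.mul_sum]
      congr 1
      refine Finset.sum_congr rfl fun l _ => ?_
      rw [tsum_mul_left]; ring
    rw [e] at h1
    rw [ha] at hap ⊢
    rw [ha] at h1
    set T := ∑ l ∈ Finset.range (j + 1), ((j + 1).choose l : ℝ) * δ ^ (j - l) * U l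
    linear_combination (-δ) * h1 + T * hδR - (δ * (n - R)) ^ (j + 1) * hap

lemma drift_integral (mu a : ℝ) (hmu : 0 < mu) (ha : 0 < a) (b : ℝ → ℝ) 
    (hb : ∀ x, b x = if x ≤ a then -(mu * x) else mu * (-a)) (x : ℝ) :
    (1 / mu) * ∫ y in (0:ℝ)..x, b y = if x ≤ a then -x ^ 2 / 2 else a ^ 2 / 2 - a * x := by
  have lin : ∀ x, x ≤ a → ∫ y in (0:ℝ)..x, b y = mu * (-x ^ 2 / 2) := by
    intro x hx
    have : ∫ y in (0:ℝ)..x, b y = ∫ y in (0:ℝ)..x, -mu * y := by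
      refine intervalIntegral.integral_congr fun y hy => ?_
      have : y ≤ a := hy.2.trans (max_le ha.le hx)
      simp only [hb, if_pos this]; ring
    rw [this, intervalIntegral.integral_const_mul, integral_id]; ring
  have hbc : Continuous b := by
    have : b = fun x => -mu * min x a := by
      ext y
      rw [hb]
      split_ifs with h
      · rw [min_eq_left h]; ring
      · rw [min_eq_right (not_le.1 h).le]; ring
    rw [this]; fun_prop
  split_ifs with h
  · rw [lin x h]; field_simp
  · push Not at h
    rw [← intervalIntegral.integral_add_adjacent_intervals (b := a) (hbc.intervalIntegrable _ _)
      (hbc.intervalIntegrable _ _), lin a le_rfl]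
    have : ∫ y in a..x, b y = ∫ y in a..x, mu * (-a) := by
      refine intervalIntegral.integral_congr fun y hy => ?_
      rw [uIcc_of_le h.le] at hy
      simp only [hb]
      split_ifs with h'
      · have : y = a := le_antisymm h' hy.1
        rw [this]; ring
      · rfl
    rw [this, intervalIntegral.integral_const]
    simp only [smul_eq_mul]
    field_simp
    ring

/-- Erlang-C higher moments: for every positive integer `m` there is a constant
`C(m) > 0` such that the error in approximating the `m`-th moment of the scaled
stationary customer count by that of the diffusion approximation is at most
`(1 + 1/|ζ|^(m-1))·C(m)·δ`, universally over parameters with `1 ≤ R < n`. -/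
theorem erlangC_higher_moments (m : ℕ) (hm : 0 < m) :
    ∃ C : ℝ, 0 < C ∧
      ∀ (lam mu : ℝ) (n : ℕ), 0 < lam → 0 < mu → 1 ≤ n →
      ∀ R δ ζ : ℝ,
        R = lam / mu → 1 ≤ R → R < (n : ℝ) →
        δ = 1 / Real.sqrt R → ζ = δ * (R - (n : ℝ)) →
      ∀ pi : ℕ → ℝ,
        (∀ k, 0 ≤ pi k) → (∑' k : ℕ, pi k) = 1 →
        (∀ k : ℕ, lam * pi k = mu * min ((k : ℝ) + 1) (n : ℝ) * pi (k + 1)) →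
      ∀ b : ℝ → ℝ,
        (∀ x : ℝ, b x = if x ≤ -ζ then -(mu * x) else mu * ζ) →
      ∀ kappa : ℝ, 0 < kappa →
      ∀ nu : ℝ → ℝ,
        (∀ x : ℝ, nu x = kappa * Real.exp ((1 / mu) * ∫ y in (0:ℝ)..x, b y)) →
        (∫ x : ℝ, nu x) = 1 →
        (Summable fun k : ℕ => pi k * (δ * ((k : ℝ) - R)) ^ m) →
        (Integrable fun x : ℝ => x ^ m * nu x) →
        |(∑' k : ℕ, pi k * (δ * ((k : ℝ) - R)) ^ m) - (∫ x : ℝ, x ^ m * nu x)|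
          ≤ (1 + 1 / |ζ| ^ (m - 1)) * C * δ := by
  obtain ⟨C1, hC1, hL⟩ := lower_err m
  obtain ⟨C2, hC2, hUp⟩ := upper_err m
  refine ⟨C1 + C2, by positivity, ?_⟩
  intro lam mu n hlam hmu hn R δ ζ hR hR1 hRn hδ hζ pi hpi hsum hrec b hb kappa hk nu hnu hnu1 _ _
  have hlamR : lam = R * mu := by rw [hR]; field_simp
  obtain ⟨a, ha⟩ : ∃ a, a = -ζ := ⟨_, rfl⟩
  have hζa : ζ = -a := by rw [ha]; ring
  obtain ⟨p, U, hLow, hUpp, hdisc⟩ := disc_part n R δ a hR1 hRn hδ (by rw [ha, hζ]; ring) pi hpi hsum (by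
    intro k
    have := hrec k
    rw [hlamR] at this
    refine mul_left_cancel₀ hmu.ne' ?_
    linarith)
  have ha0 := hLow.a_pos
  have hδ0 := hLow.δ_pos
  have hdr := drift_integral mu a hmu ha0 b (by
    intro x
    rw [hb, hζa, neg_neg])
  obtain ⟨q, N, V, hq, hN0, hN1, hN, hV0, hV, hcont⟩ := cont_part a kappa ha0 nu
    (by intro x hx; rw [hnu, hdr, if_pos hx])
    (by intro x hx; rw [hnu, hdr, if_neg (not_le.2 hx)]) hnu1
  rw [hdisc, hcont]
  have b1 := hL n pi _ a δ p hLow q hq N hN0 hN1 hN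
  have b2 := hUp n pi _ a δ p hLow U hUpp q hq V hV0 hV
  have habs : |ζ| = a := by rw [hζa, abs_neg, abs_of_pos ha0]
  rw [habs]
  have hinv : 0 ≤ 1 / a ^ (m - 1) := by positivity
  have b3 : |U m - V m| ≤ (1 + 1 / a ^ (m - 1)) * (C2 * δ) := by
    obtain ⟨l, rfl⟩ : ∃ l, m = l + 1 := ⟨m - 1, by omega⟩
    simp only [Nat.add_sub_cancel] at hinv ⊢
    rcases le_total a 1 with h | h
    · rw [min_eq_left h, pow_succ, ← mul_assoc] at b2
      have b4 := le_of_mul_le_mul_right b2 ha0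
      rw [← le_div_iff₀ (by positivity)] at b4
      refine b4.trans ?_
      rw [div_eq_mul_one_div, mul_comm]
      gcongr
      linarith
    · rw [min_eq_right h] at b2
      simp only [one_pow, mul_one] at b2
      nlinarith [mul_nonneg hinv (mul_pos hC2 hδ0).le]
  set M := ∑ k ∈ Finset.range n, pi k * (δ * ((k:ℝ) - R)) ^ m
  calc |M + U m - (N m + V m)| = |(M - N m) + (U m - V m)| := by congr 1; ring
    _ ≤ |M - N m| + |U m - V m| := abs_add_le _ _
    _ ≤ C1 * δ + (1 + 1 / a ^ (m - 1)) * (C2 * δ) := by gcongr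
    _ ≤ _ := by nlinarith [mul_nonneg hinv (mul_pos hC1 hδ0).le]
end

section
/- There exists a constant C > 0, independent of λ, n and μ, such that for all λ > 0, μ > 0 and every integer n ≥ 1 with 1 ≤ R < n (where R = λ/μ), the scaled stationary Erlang-C customer count and the state-dependent diffusion approximation satisfy d_{W₂}(X̃(∞), Y_S(∞)) = sup_{h ∈ W₂} |E h(X̃(∞)) − E h(Y_S(∞))| ≤ C/R. -/
open MeasureTheory Set

section Helpers
open Filter Topology



noncomputable def aF (δ z x : ℝ) : ℝ := 1 + max 0 (1 + δ * min x z)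
noncomputable def bF (z x : ℝ) : ℝ := - min x z

structure SteinSol (δ z : ℝ) (G H p : ℝ → ℝ) : Prop where
  hδ : 0 < δ
  hδ1 : δ ≤ 1
  hz : 0 < z
  lip : ∀ x y, |H x - H y| ≤ |x - y|
  ode : ∀ x, HasDerivAt G (2 / aF δ z x * (H x - bF z x * G x)) x
  ppos : ∀ x, 0 < p x
  pder : ∀ x, HasDerivAt p (2 * bF z x / aF δ z x * p x) x
  bot : Tendsto (fun x => G x * p x) atBot (𝓝 0)
  top : Tendsto (fun x => G x * p x) atTop (𝓝 0)

lemma aF_ge (δ z x : ℝ) : 1 ≤ aF δ z x := by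
  unfold aF; linarith [le_max_left 0 (1 + δ * min x z)]

lemma aF_mid {δ z x : ℝ} (hδ : 0 < δ) (h1 : -(1/δ) ≤ x) (h2 : x ≤ z) : aF δ z x = 2 + δ * x := by
  unfold aF
  have : -1 ≤ δ * x := by
    have := mul_le_mul_of_nonneg_left h1 hδ.le
    have e : δ * -(1/δ) = -1 := by field_simp
    linarith
  rw [min_eq_left h2, max_eq_right (by linarith)]; ring

lemma aF_right {δ z x : ℝ} (hδ : 0 < δ) (hz : 0 < z) (h2 : z ≤ x) : aF δ z x = 2 + δ * z := by
  unfold aF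
  rw [min_eq_right h2, max_eq_right (by positivity)]; ring

lemma aF_neg_le {δ z x : ℝ} (hδ : 0 < δ) (hz : 0 < z) (h : x ≤ 0) : aF δ z x ≤ 2 := by
  unfold aF
  rw [min_eq_left (by linarith)]
  have : max 0 (1 + δ * x) ≤ 1 := max_le (by norm_num) (by nlinarith)
  linarith

lemma bF_left {z x : ℝ} (h : x ≤ z) : bF z x = -x := by unfold bF; rw [min_eq_left h]
lemma bF_right {z x : ℝ} (h : z ≤ x) : bF z x = -z := by unfold bF; rw [min_eq_right h]

namespace SteinSol
variable {δ z : ℝ} {G H p : ℝ → ℝ}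

lemma neg (S : SteinSol δ z G H p) : SteinSol δ z (fun x => -G x) (fun x => -H x) p where
  hδ := S.hδ
  hδ1 := S.hδ1
  hz := S.hz
  lip x y := by
    have := S.lip y x
    rw [abs_sub_comm y x] at this
    have e : -H x - -H y = H y - H x := by ring
    rw [e]; exact this
  ode x := by
    exact (S.ode x).neg.congr_deriv (by ring)
  ppos := S.ppos
  pder := S.pder
  bot := by simpa using S.bot.neg
  top := by simpa using S.top.neg

lemma der (S : SteinSol δ z G H p) {V : ℝ → ℝ} {v x : ℝ} (hV : HasDerivAt V v x) :
    HasDerivAt (fun x => (V x - G x) * p x)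
      (2 / aF δ z x * (aF δ z x / 2 * v + bF z x * V x - H x) * p x) x := by
  have ha := aF_ge δ z x
  refine HasDerivAt.congr_deriv ((hV.sub (S.ode x)).mul (S.pder x)) ?_
  simp only [Pi.sub_apply]
  field_simp
  ring

lemma mono (S : SteinSol δ z G H p) {V v : ℝ → ℝ} {D : Set ℝ} (hD : Convex ℝ D)
    (hV : ∀ x, HasDerivAt V (v x) x)
    (h : ∀ x ∈ D, H x ≤ aF δ z x / 2 * v x + bF z x * V x) :
    MonotoneOn (fun x => (V x - G x) * p x) D := by
  apply monotoneOn_of_deriv_nonneg hD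
  · exact fun x _ => (S.der (hV x)).continuousAt.continuousWithinAt
  · exact fun x _ => (S.der (hV x)).differentiableAt.differentiableWithinAt
  · intro x hx
    rw [(S.der (hV x)).deriv]
    have ha := aF_ge δ z x
    have := h x (interior_subset hx)
    have := S.ppos x
    apply mul_nonneg (mul_nonneg (by positivity) (by linarith)) this.le

lemma anti (S : SteinSol δ z G H p) {V v : ℝ → ℝ} {D : Set ℝ} (hD : Convex ℝ D)
    (hV : ∀ x, HasDerivAt V (v x) x)
    (h : ∀ x ∈ D, aF δ z x / 2 * v x + bF z x * V x ≤ H x) :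
    AntitoneOn (fun x => (V x - G x) * p x) D := by
  apply antitoneOn_of_deriv_nonpos hD
  · exact fun x _ => (S.der (hV x)).continuousAt.continuousWithinAt
  · exact fun x _ => (S.der (hV x)).differentiableAt.differentiableWithinAt
  · intro x hx
    rw [(S.der (hV x)).deriv]
    have ha := aF_ge δ z x
    have := h x (interior_subset hx)
    have := S.ppos x
    apply mul_nonpos_of_nonpos_of_nonneg _ this.le
    apply mul_nonpos_of_nonneg_of_nonpos (by positivity) (by linarith)

lemma le_of_D (S : SteinSol δ z G H p) {v x : ℝ} (h : 0 ≤ (v - G x) * p x) : G x ≤ v := by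
  have := S.ppos x
  have := nonneg_of_mul_nonneg_left h this
  linarith

lemma D_of_le (S : SteinSol δ z G H p) {v x : ℝ} (h : G x ≤ v) : 0 ≤ (v - G x) * p x :=
  mul_nonneg (by linarith) (S.ppos x).le

/-- forward comparison on an interval -/
lemma fwd (S : SteinSol δ z G H p) {V v : ℝ → ℝ} {s t : ℝ}
    (hV : ∀ x, HasDerivAt V (v x) x)
    (h : ∀ x ∈ Icc s t, H x ≤ aF δ z x / 2 * v x + bF z x * V x) (h0 : G s ≤ V s)
    {x : ℝ} (hx : x ∈ Icc s t) : G x ≤ V x :=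
  S.le_of_D ((S.D_of_le h0).trans
    (S.mono (convex_Icc s t) hV h (left_mem_Icc.2 (hx.1.trans hx.2)) hx hx.1))

lemma bwd (S : SteinSol δ z G H p) {V v : ℝ → ℝ} {s t : ℝ}
    (hV : ∀ x, HasDerivAt V (v x) x)
    (h : ∀ x ∈ Icc s t, aF δ z x / 2 * v x + bF z x * V x ≤ H x) (h0 : G t ≤ V t)
    {x : ℝ} (hx : x ∈ Icc s t) : G x ≤ V x :=
  S.le_of_D ((S.D_of_le h0).trans
    (S.anti (convex_Icc s t) hV h hx (right_mem_Icc.2 (hx.1.trans hx.2)) hx.2))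

/-- comparison from -∞ with constants -/
lemma fromBot (S : SteinSol δ z G H p) {B t : ℝ} (hB : 0 ≤ B)
    (h : ∀ x ≤ t, H x ≤ bF z x * B) {x : ℝ} (hx : x ≤ t) : G x ≤ B := by
  apply S.le_of_D
  have hm := S.mono (V := fun _ => B) (v := fun _ => 0) (convex_Iic t)
    (fun x => hasDerivAt_const x B) (fun x hx => by simpa using h x hx)
  have lim : Tendsto (fun y => -(G y * p y)) atBot (𝓝 0) := by simpa using S.bot.neg
  apply le_of_tendsto lim
  filter_upwards [eventually_le_atBot x] with y hy
  have := hm (hy.trans hx : y ∈ Iic t) (hx : x ∈ Iic t) hy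
  try simp only at this
  have h2 : 0 ≤ B * p y := mul_nonneg hB (S.ppos y).le
  nlinarith

lemma H_le (S : SteinSol δ z G H p) (x y : ℝ) : H x ≤ H y + |x - y| := by
  have := (abs_le.1 (S.lip x y)).2; linarith

lemma abs_H_le (S : SteinSol δ z G H p) (x : ℝ) : |H x| ≤ |H 0| + |x| := by
  have := S.lip x 0
  have h2 := abs_sub_abs_le_abs_sub (H x) (H 0)
  simp at this; linarith

/-- left bound, one sided -/
lemma left_le (S : SteinSol δ z G H p) {x : ℝ} (hx : x ≤ 0) : G x ≤ 3 * (|H 0| + 1) := by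
  set B := |H 0| + 1 with hB
  have hB0 : 0 ≤ |H 0| := abs_nonneg _
  have hz := S.hz
  have hHx : ∀ x, H x ≤ |H 0| + |x| := fun x => (le_abs_self _).trans (S.abs_H_le x)
  have h1 : ∀ x ≤ -1, G x ≤ B := fun x hx => by
    apply S.fromBot (t := -1) (by linarith) _ hx
    intro y hy
    have := hHx y
    rw [bF_left (by linarith)]
    rw [abs_of_neg (a := y) (by linarith)] at this
    nlinarith
  rcases le_total x (-1) with h | h
  · linarith [h1 x h]
  · have := S.fwd (V := fun x => B * (3 + 2 * x)) (v := fun _ => B * 2) (s := -1) (t := 0)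
      (fun x => by
        simpa using (((hasDerivAt_id x).const_mul 2).const_add 3).const_mul B)
      (fun y hy => by
        have h3 := hHx y
        have ha := aF_ge δ z y
        rw [bF_left (by linarith [hy.2])]
        have h5 := hy.1
        have h6 := hy.2
        rw [abs_of_nonpos hy.2] at h3
        have h4 : 0 ≤ (-y) * (B * (3 + 2 * y)) := 
          mul_nonneg (by linarith) (mul_nonneg (by linarith) (by linarith))
        nlinarith)
      (by have := h1 (-1) le_rfl; linarith) ⟨h, hx⟩
    try simp only at this
    nlinarith

/-- right bound, one sided; only needs the equation on the right -/
lemma right_core {A z x0 : ℝ} {u r q : ℝ → ℝ} (hA : 0 < A) (hz : 0 < z)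
    (hr : ∀ x, x0 ≤ x → r x0 - (x - x0) ≤ r x)
    (hu : ContinuousOn u (Ici x0)) (hud : ∀ x, x0 < x → HasDerivAt u (2 / A * (r x + z * u x)) x)
    (hq : ∀ x, 0 < q x) (hqc : ContinuousOn q (Ici x0))
    (hqd : ∀ x, x0 < x → HasDerivAt q (-(2 * z / A) * q x) x)
    (ht : Tendsto (fun x => u x * q x) atTop (𝓝 0)) :
    r x0 + z * u x0 ≤ A / (2 * z) := by
  set W : ℝ → ℝ := fun x => (x - x0) / z + A / (2 * z^2) - r x0 / z with hW
  have hWd : ∀ x, HasDerivAt W (1 / z) x := fun x => by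
    exact ((((hasDerivAt_id x).sub_const x0).div_const z).add_const (A / (2 * z^2))).sub_const
      (r x0 / z)
  have hWc : Continuous W := by fun_prop
  have hder : ∀ x, x0 < x → HasDerivAt (fun x => (W x - u x) * q x)
      (2 / A * (r x0 - (x - x0) - r x) * q x) x := fun x hx => by
    refine HasDerivAt.congr_deriv (((hWd x).sub (hud x hx)).mul (hqd x hx)) ?_
    simp only [hW, Pi.sub_apply]
    field_simp
    ring
  have hanti : AntitoneOn (fun x => (W x - u x) * q x) (Ici x0) := by
    apply antitoneOn_of_deriv_nonpos (convex_Ici x0)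
    · exact (hWc.continuousOn.sub hu).mul hqc
    · intro x hx
      rw [interior_Ici] at hx
      exact (hder x hx).differentiableAt.differentiableWithinAt
    · intro x hx
      rw [interior_Ici] at hx
      rw [(hder x hx).deriv]
      have := hr x (le_of_lt hx)
      have := hq x
      apply mul_nonpos_of_nonpos_of_nonneg _ this.le
      apply mul_nonpos_of_nonneg_of_nonpos (by positivity) (by linarith)
  have lim : Tendsto (fun y => -(u y * q y)) atTop (𝓝 0) := by simpa using ht.neg
  have hge : 0 ≤ (W x0 - u x0) * q x0 := by
    apply le_of_tendsto lim
    filter_upwards [eventually_ge_atTop x0, eventually_ge_atTop (x0 + r x0)] with y hy hy2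
    have h1 := hanti self_mem_Ici (hy : y ∈ Ici x0) hy
    try simp only at h1
    have h2 : 0 ≤ W y * q y := by
      apply mul_nonneg _ (hq y).le
      have e : W y = (y - x0 - r x0) / z + A / (2 * z^2) := by simp only [hW]; ring
      rw [e]
      have : 0 ≤ y - x0 - r x0 := by linarith
      positivity
    nlinarith
  have h3 := nonneg_of_mul_nonneg_left hge (hq x0)
  have e : A / (2 * z) - (r x0 + z * u x0) = z * (W x0 - u x0) := by
    simp only [hW]; field_simp; ring
  have := mul_nonneg hz.le h3
  linarith

lemma right_le (S : SteinSol δ z G H p) {x : ℝ} (hx : z ≤ x) :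
    H x + z * G x ≤ (2 + δ * z) / (2 * z) := by
  have hz := S.hz
  have hδ := S.hδ
  apply right_core (u := G) (r := H) (q := p) (by positivity) hz
  · intro y hy
    have := S.H_le x y
    rw [abs_sub_comm, abs_of_nonneg (by linarith)] at this
    linarith
  · exact fun y _ => (S.ode y).continuousAt.continuousWithinAt
  · intro y hy
    have := S.ode y
    rw [aF_right hδ hz (by linarith), bF_right (by linarith)] at this
    convert this using 1; ring
  · exact S.ppos
  · exact fun y _ => (S.pder y).continuousAt.continuousWithinAt
  · intro y hy
    have := S.pder y
    rw [aF_right hδ hz (by linarith), bF_right (by linarith)] at this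
    convert this using 1; ring
  · exact S.top

lemma right_abs (S : SteinSol δ z G H p) {x : ℝ} (hx : z ≤ x) :
    |H x + z * G x| ≤ (2 + δ * z) / (2 * z) := by
  rw [abs_le]
  refine ⟨?_, S.right_le hx⟩
  have := S.neg.right_le hx
  linarith

lemma H0_le (S : SteinSol δ z G H p) : H 0 ≤ 4 + 1 / z := by
  by_contra! hc
  have hz := S.hz
  have hδ := S.hδ
  have hz' : 0 < 1 / z := by positivity
  have hH : ∀ x, H 0 - |x| ≤ H x := fun x => by
    have := S.H_le 0 x; simp at this; linarith
  have h1 : ∀ x ≤ -1, -G x ≤ 1 := fun x hx => by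
    apply S.neg.fromBot (t := -1) (by linarith) _ hx
    intro y hy
    have := hH y
    rw [bF_left (by linarith)]
    rw [abs_of_neg (a := y) (by linarith)] at this
    linarith
  have h2 := S.neg.fwd (V := fun x => 1 - 3 * (1 + x)) (v := fun _ => -3) (s := -1) (t := 0)
      (fun x => by
        simpa using (((hasDerivAt_id x).const_add 1).const_mul 3).const_sub 1)
      (fun y hy => by
        have h3 := hH y
        have ha := aF_neg_le (x := y) hδ hz hy.2
        have h5 := hy.1
        have h6 := hy.2
        rw [bF_left (by linarith [hy.2])]
        rw [abs_of_nonpos hy.2] at h3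
        nlinarith [sq_nonneg (y + 1 / 2)])
      (by have := h1 (-1) le_rfl; linarith) ⟨by norm_num, le_rfl⟩
  try simp only at h2
  have h3 := S.right_le (le_refl z)
  have e : (2 + δ * z) / (2 * z) = 1 / z + δ / 2 := by field_simp
  rw [e] at h3
  have hz4 := hH z
  rw [abs_of_pos hz] at hz4
  have h5 : G z ≤ 1 := by
    have := S.hδ1
    by_contra! hc
    nlinarith
  have h6 := S.bwd (V := fun _ => 1) (v := fun _ => 0) (s := 0) (t := z)
    (fun x => hasDerivAt_const x 1) (fun y hy => by
      have h3 := hH y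
      rw [bF_left hy.2]
      rw [abs_of_nonneg hy.1] at h3
      linarith) h5 ⟨le_rfl, hz.le⟩
  try simp only at h6
  linarith

lemma H0_abs (S : SteinSol δ z G H p) : |H 0| ≤ 4 + 1 / z := by
  rw [abs_le]
  have := S.neg.H0_le
  exact ⟨by linarith, S.H0_le⟩

lemma mid1 (S : SteinSol δ z G H p) {x : ℝ} (h0 : 0 ≤ x) (h1 : x ≤ 1) (hxz : x ≤ z) :
    G x ≤ 36 * (|H 0| + 1) := by
  set B := |H 0| + 1 with hB
  have hB0 : 0 ≤ |H 0| := abs_nonneg _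
  have hz := S.hz
  have hδ := S.hδ
  have h2 := S.fwd (V := fun x => 4 * B * Real.exp (2 * x)) (v := fun x => 4 * B * (Real.exp (2 * x) * 2)) 
      (s := 0) (t := x)
      (fun x => by
        have := ((hasDerivAt_id x).const_mul 2).exp.const_mul (4 * B)
        simpa using this)
      (fun y hy => by
        have h3 : H y ≤ |H 0| + |y| := (le_abs_self _).trans (S.abs_H_le y)
        have h5 := hy.1
        have h6 := hy.2
        rw [abs_of_nonneg hy.1] at h3
        rw [bF_left (by linarith)]
        rw [aF_mid hδ ((neg_nonpos.2 (by positivity)).trans h5) (by linarith)]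
        have hE : 1 ≤ Real.exp (2 * y) := Real.one_le_exp (by linarith)
        set E := Real.exp (2 * y)
        have hBE : B ≤ B * E := by nlinarith
        have k1 : 0 ≤ (δ * y) * (B * E) := by positivity
        have k2 : 0 ≤ (1 - y) * (B * E) := mul_nonneg (by linarith) (by linarith)
        nlinarith)
      (by have := S.left_le (le_refl 0); simp; linarith) ⟨h0, le_rfl⟩
  try simp only at h2
  have h3 : Real.exp (2 * x) ≤ 9 := by
    calc Real.exp (2 * x) ≤ Real.exp 2 := Real.exp_le_exp.2 (by linarith)
      _ = Real.exp 1 ^ 2 := by rw [← Real.exp_nat_mul]; norm_num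
      _ ≤ 9 := by nlinarith [Real.exp_one_lt_d9, Real.exp_pos 1]
  nlinarith

lemma left_all (S : SteinSol δ z G H p) {x : ℝ} (hx : x ≤ z) : G x ≤ 36 * (|H 0| + 1) := by
  have hB0 : 0 ≤ |H 0| := abs_nonneg _
  have hz := S.hz
  have hδ := S.hδ
  rcases le_total x 0 with h | h
  · linarith [S.left_le h]
  rcases le_total x 1 with h1 | h1
  · exact S.mid1 h h1 hx
  set B := |H 0| + 1 with hB
  have hz1 : 1 ≤ z := h1.trans hx
  have hG : G z ≤ 3 * B := by
    have h3 := S.right_le (le_refl z)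
    have e : (2 + δ * z) / (2 * z) = 1 / z + δ / 2 := by field_simp
    rw [e] at h3
    have := S.hδ1
    have h4 : 1 / z ≤ 1 := by rw [div_le_one hz]; exact hz1
    have h5 := neg_abs_le (H z)
    have h6 := S.abs_H_le z
    rw [abs_of_pos hz] at h6
    by_contra! hc
    nlinarith
  have h6 := S.bwd (V := fun _ => 3 * B) (v := fun _ => 0) (s := 1) (t := z)
    (fun x => hasDerivAt_const x _) (fun y hy => by
      have h5 := neg_abs_le (H y)
      have h6 := S.abs_H_le y
      have h7 := hy.1
      rw [bF_left hy.2]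
      rw [abs_of_nonneg (a := y) (by linarith [hy.1])] at h6
      nlinarith) hG ⟨h1, hx⟩
  try simp only at h6
  linarith

lemma left_abs (S : SteinSol δ z G H p) {x : ℝ} (hx : x ≤ z) : |G x| ≤ 180 * (1 + 1 / z) := by
  have h1 := S.left_all hx
  have h2 := S.neg.left_all hx
  have h3 := S.H0_abs
  simp only [abs_neg] at h2
  have : 0 < 1 / z := by have := S.hz; positivity
  rw [abs_le]; constructor <;> linarith

end SteinSol


lemma taylor_right {f f1 f2 : ℝ → ℝ} {x y c M : ℝ} (hxy : x < y)
    (hf : ∀ t ∈ Icc x y, HasDerivAt f (f1 t) t) (hc : ContinuousOn f1 (Icc x y))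
    (hf1 : ∀ t ∈ Ioo x y, HasDerivAt f1 (f2 t) t) (hM : ∀ t ∈ Ioo x y, |f2 t - c| ≤ M) :
    |f y - f x - (y - x) * f1 x - (y - x)^2 / 2 * c| ≤ M * (y - x)^2 := by
  have hM0 : 0 ≤ M := by
    have := hM ((x + y)/2) ⟨by linarith, by linarith⟩
    exact (abs_nonneg _).trans this
  have step1 : ∀ t ∈ Ioo x y, |f1 t - f1 x - c * (t - x)| ≤ M * (t - x) := by
    intro t ht
    obtain ⟨ξ, hξ, e⟩ := exists_hasDerivAt_eq_slope f1 f2 ht.1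
      (hc.mono (Icc_subset_Icc_right ht.2.le))
      (fun s hs => hf1 s ⟨hs.1, hs.2.trans ht.2⟩)
    have hp : 0 < t - x := by linarith [ht.1]
    rw [eq_div_iff hp.ne'] at e
    rw [← e, ← sub_mul, abs_mul, abs_of_pos hp]
    exact mul_le_mul_of_nonneg_right (hM ξ ⟨hξ.1, hξ.2.trans ht.2⟩) hp.le
  have hφ : ∀ t ∈ Icc x y, HasDerivAt (fun t => f t - f1 x * (t - x) - c * ((t - x)^2 / 2))
      (f1 t - f1 x - c * (t - x)) t := by
    intro t ht
    have h1 := ((hasDerivAt_id t).sub_const x)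
    refine HasDerivAt.congr_deriv
      (((hf t ht).sub (h1.const_mul (f1 x))).sub (((h1.pow 2).div_const 2).const_mul c)) ?_
    simp
  obtain ⟨η, hη, e⟩ := exists_hasDerivAt_eq_slope _ _ hxy
    (fun t ht => (hφ t ht).continuousAt.continuousWithinAt) (fun t ht => hφ t ⟨ht.1.le, ht.2.le⟩)
  have hp : 0 < y - x := by linarith
  rw [eq_div_iff hp.ne'] at e
  have e2 : f y - f x - (y - x) * f1 x - (y - x)^2 / 2 * c
      = (f1 η - f1 x - c * (η - x)) * (y - x) := by rw [e]; ring
  rw [e2, abs_mul, abs_of_pos hp]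
  have := step1 η hη
  have h3 : M * (η - x) ≤ M * (y - x) := by
    apply mul_le_mul_of_nonneg_left _ hM0; linarith [hη.2]
  nlinarith

lemma taylor_left {f f1 f2 : ℝ → ℝ} {x y c M : ℝ} (hxy : x < y)
    (hf : ∀ t ∈ Icc x y, HasDerivAt f (f1 t) t) (hc : ContinuousOn f1 (Icc x y))
    (hf1 : ∀ t ∈ Ioo x y, HasDerivAt f1 (f2 t) t) (hM : ∀ t ∈ Ioo x y, |f2 t - c| ≤ M) :
    |f x - f y + (y - x) * f1 y - (y - x)^2 / 2 * c| ≤ M * (y - x)^2 := by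
  have hd : ∀ t : ℝ, HasDerivAt (fun t : ℝ => -t) (-1) t := fun t => (hasDerivAt_id t).neg
  have hm : ∀ t ∈ Icc (-y) (-x), -t ∈ Icc x y := fun t ht => ⟨by linarith [ht.2], by linarith [ht.1]⟩
  have := taylor_right (f := fun t => f (-t)) (f1 := fun t => -f1 (-t)) (f2 := fun t => f2 (-t))
    (x := -y) (y := -x) (c := c) (M := M) (by linarith)
    (fun t ht => by
      refine HasDerivAt.congr_deriv ((hf (-t) (hm t ht)).comp t (hd t)) (by ring))
    (by
      apply ContinuousOn.neg
      exact hc.comp (continuous_neg.continuousOn) hm)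
    (fun t ht => by
      refine HasDerivAt.congr_deriv ((hf1 (-t) ⟨by linarith [ht.2], by linarith [ht.1]⟩).comp t (hd t)).neg
        (by ring))
    (fun t ht => hM (-t) ⟨by linarith [ht.2], by linarith [ht.1]⟩)
  simp only [neg_neg] at this
  have e : -x - -y = y - x := by ring
  rw [e] at this
  convert this using 2
  ring

lemma aF_cont (δ z : ℝ) : Continuous (aF δ z) := by unfold aF; fun_prop
lemma bF_cont (z : ℝ) : Continuous (bF z) := by unfold bF; fun_prop

namespace SteinSol
variable {δ z : ℝ} {G H p h1 : ℝ → ℝ}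

noncomputable def G1 (δ z : ℝ) (G H : ℝ → ℝ) (x : ℝ) : ℝ := 2 / aF δ z x * (H x - bF z x * G x)
noncomputable def G2L (δ z : ℝ) (G H h1 : ℝ → ℝ) (x : ℝ) : ℝ :=
  2 / (2 + δ * x) * (h1 x + G x + (x - δ / 2) * G1 δ z G H x)
noncomputable def G2R (δ z : ℝ) (G H h1 : ℝ → ℝ) (x : ℝ) : ℝ :=
  2 / (2 + δ * z) * (h1 x + z * G1 δ z G H x)

lemma H_cont (S : SteinSol δ z G H p) : Continuous H := by
  have : LipschitzWith 1 H := LipschitzWith.of_dist_le_mul (fun x y => by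
    simpa [Real.dist_eq] using S.lip x y)
  exact this.continuous

lemma G_cont (S : SteinSol δ z G H p) : Continuous G :=
  continuous_iff_continuousAt.2 fun x => (S.ode x).continuousAt

lemma G1_cont (S : SteinSol δ z G H p) : Continuous (G1 δ z G H) := by
  unfold G1
  have := S.H_cont
  have := S.G_cont
  have := aF_cont δ z
  have := bF_cont z
  have h : ∀ x, aF δ z x ≠ 0 := fun x => by linarith [aF_ge δ z x]
  fun_prop (disch := assumption)

lemma a_pos (hδ : 0 < δ) {x : ℝ} (h : -(1/δ) ≤ x) : 1 ≤ 2 + δ * x := by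
  have := mul_le_mul_of_nonneg_left h hδ.le
  have e : δ * -(1/δ) = -1 := by field_simp
  linarith

lemma G1_left (S : SteinSol δ z G H p) {x : ℝ} (h : -(1/δ) ≤ x) (h2 : x ≤ z) :
    G1 δ z G H x = 2 / (2 + δ * x) * (H x + x * G x) := by
  unfold G1; rw [aF_mid S.hδ h h2, bF_left h2]; ring

lemma G1_right (S : SteinSol δ z G H p) {x : ℝ} (h2 : z ≤ x) :
    G1 δ z G H x = 2 / (2 + δ * z) * (H x + z * G x) := by
  unfold G1; rw [aF_right S.hδ S.hz h2, bF_right h2]; ring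

lemma derL (S : SteinSol δ z G H p) (hh : ∀ x, HasDerivAt H (h1 x) x) {x : ℝ}
    (hx : x ∈ Ioo (-(1/δ)) z) : HasDerivAt (G1 δ z G H) (G2L δ z G H h1 x) x := by
  have ha := a_pos S.hδ hx.1.le
  have e : G1 δ z G H =ᶠ[𝓝 x] fun x => 2 / (2 + δ * x) * (H x + x * G x) := by
    filter_upwards [Ioo_mem_nhds hx.1 hx.2] with y hy
    exact S.G1_left hy.1.le hy.2.le
  apply HasDerivAt.congr_of_eventuallyEq _ e
  have hG : HasDerivAt G (G1 δ z G H x) x := S.ode x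
  have d1 : HasDerivAt (fun x => 2 + δ * x) δ x := by
    simpa using ((hasDerivAt_id x).const_mul δ).const_add 2
  have d2 := ((hasDerivAt_const x (2:ℝ)).div d1 (by linarith)).mul
    ((hh x).add ((hasDerivAt_id x).mul hG))
  refine HasDerivAt.congr_deriv d2 ?_
  unfold G2L
  simp only [Pi.add_apply, Pi.mul_apply, Pi.div_apply, id]
  have e3 : G1 δ z G H x * (2 + δ * x) = 2 * (H x + x * G x) := by
    rw [S.G1_left hx.1.le hx.2.le]; field_simp
  have e4 : H x = G1 δ z G H x * (2 + δ * x) / 2 - x * G x := by linarith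
  rw [e4]
  field_simp
  ring

lemma derR (S : SteinSol δ z G H p) (hh : ∀ x, HasDerivAt H (h1 x) x) {x : ℝ}
    (hx : z < x) : HasDerivAt (G1 δ z G H) (G2R δ z G H h1 x) x := by
  have e : G1 δ z G H =ᶠ[𝓝 x] fun x => 2 / (2 + δ * z) * (H x + z * G x) := by
    filter_upwards [Ioi_mem_nhds hx] with y hy
    exact S.G1_right (le_of_lt hy)
  apply HasDerivAt.congr_of_eventuallyEq _ e
  have hG : HasDerivAt G (G1 δ z G H x) x := S.ode x
  exact ((hh x).add (hG.const_mul z)).const_mul _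

lemma G1R_abs (S : SteinSol δ z G H p) {x : ℝ} (hx : z ≤ x) : |G1 δ z G H x| ≤ 1 / z := by
  have hz := S.hz
  have hδ := S.hδ
  rw [S.G1_right hx, abs_mul, abs_of_pos (by positivity)]
  calc _ ≤ 2 / (2 + δ * z) * ((2 + δ * z) / (2 * z)) :=
        mul_le_mul_of_nonneg_left (S.right_abs hx) (by positivity)
    _ = 1 / z := by field_simp

lemma w_right {A z x0 B : ℝ} {w r : ℝ → ℝ} (hA : 0 < A) (hz : 0 < z)
    (hr : ∀ x y, |r x - r y| ≤ |x - y|)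
    (hu : Continuous w) (hud : ∀ x, x0 < x → HasDerivAt w (2 / A * (r x + z * w x)) x)
    (hB : ∀ x, x0 ≤ x → |w x| ≤ B) :
    r x0 + z * w x0 ≤ A / (2 * z) := by
  set θ := 2 * z / A with hθ
  have hθ0 : 0 < θ := by positivity
  have hqd : ∀ x, HasDerivAt (fun x => Real.exp (-θ * x)) (-θ * Real.exp (-θ * x)) x := fun x => by
    have := ((hasDerivAt_id x).const_mul (-θ)).exp
    refine HasDerivAt.congr_deriv this ?_
    simp [mul_comm]
  apply right_core (u := w) (r := r) (q := fun x => Real.exp (-θ * x)) hA hz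
  · intro y hy
    have := (abs_le.1 (hr x0 y)).2
    rw [abs_sub_comm, abs_of_nonneg (by linarith)] at this
    linarith
  · exact hu.continuousOn
  · exact hud
  · exact fun x => Real.exp_pos _
  · exact fun x _ => (hqd x).continuousAt.continuousWithinAt
  · exact fun x _ => hqd x
  · have lim : Tendsto (fun x => B * Real.exp (-θ * x)) atTop (𝓝 0) := by
      rw [← mul_zero B]
      apply Tendsto.const_mul
      apply Real.tendsto_exp_atBot.comp
      exact tendsto_id.const_mul_atTop_of_neg (by linarith)
    apply squeeze_zero_norm' _ lim
    filter_upwards [eventually_ge_atTop x0] with y hy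
    rw [norm_mul, Real.norm_eq_abs, Real.norm_eq_abs, abs_of_pos (Real.exp_pos _)]
    exact mul_le_mul_of_nonneg_right (hB y hy) (Real.exp_pos _).le

lemma G2R_abs (S : SteinSol δ z G H p) (hh : ∀ x, HasDerivAt H (h1 x) x)
    (hl : ∀ x y, |h1 x - h1 y| ≤ |x - y|) {x : ℝ} (hx : z ≤ x) :
    |G2R δ z G H h1 x| ≤ 1 / z := by
  have hz := S.hz
  have hδ := S.hδ
  have hA : 0 < 2 + δ * z := by positivity
  have u1 : h1 x + z * G1 δ z G H x ≤ (2 + δ * z) / (2 * z) :=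
    w_right (B := 1 / z) hA hz hl S.G1_cont (fun y hy => S.derR hh (by linarith))
      (fun y hy => S.G1R_abs (by linarith))
  have u2 : -h1 x + z * -G1 δ z G H x ≤ (2 + δ * z) / (2 * z) :=
    w_right (B := 1 / z) (w := fun x => -G1 δ z G H x) (r := fun x => -h1 x) hA hz
      (fun x y => by
        rw [show -h1 x - -h1 y = h1 y - h1 x by ring, abs_sub_comm x y]; exact hl y x)
      S.G1_cont.neg (fun y hy => by
        refine HasDerivAt.congr_deriv (S.derR hh (x := y) (by linarith)).neg ?_
        unfold G2R; ring)
      (fun y hy => by rw [abs_neg]; exact S.G1R_abs (by linarith))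
  unfold G2R
  rw [abs_mul, abs_of_pos (by positivity)]
  calc _ ≤ 2 / (2 + δ * z) * ((2 + δ * z) / (2 * z)) :=
        mul_le_mul_of_nonneg_left (abs_le.2 ⟨by linarith, u1⟩) (by positivity)
    _ = 1 / z := by field_simp

/-- Lipschitz bound from derivative bound on interior, in either order -/
lemma lip_of {f f' : ℝ → ℝ} {s t B : ℝ} (hc : Continuous f) 
    (hf : ∀ y ∈ Ioo (min s t) (max s t), HasDerivAt f (f' y) y)
    (hB : ∀ y ∈ Ioo (min s t) (max s t), |f' y| ≤ B) : |f t - f s| ≤ B * |t - s| := by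
  wlog h : s ≤ t generalizing s t
  · rw [abs_sub_comm, abs_sub_comm t s]
    apply this
    · rwa [min_comm, max_comm]
    · rwa [min_comm, max_comm]
    · exact le_of_not_ge h
  rw [min_eq_left h, max_eq_right h] at hf hB
  rcases h.eq_or_lt with rfl | h
  · simp
  obtain ⟨ξ, hξ, e⟩ := exists_hasDerivAt_eq_slope f f' h hc.continuousOn hf
  have hp : 0 < t - s := by linarith
  rw [eq_div_iff hp.ne'] at e
  rw [← e, abs_mul]
  exact mul_le_mul_of_nonneg_right (hB ξ hξ) (abs_nonneg _)

lemma G2R_lip (S : SteinSol δ z G H p) (hh : ∀ x, HasDerivAt H (h1 x) x)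
    (hl : ∀ x y, |h1 x - h1 y| ≤ |x - y|) {x y : ℝ} (hx : z ≤ x) (hy : z ≤ y) :
    |G2R δ z G H h1 y - G2R δ z G H h1 x| ≤ 4 / (2 + δ * z) * |y - x| := by
  have hz := S.hz
  have hδ := S.hδ
  have h2 := lip_of (s := x) (t := y) (B := 1 / z) S.G1_cont
    (fun t ht => S.derR hh (lt_of_le_of_lt (le_min hx hy) ht.1))
    (fun t ht => S.G2R_abs hh hl ((le_min hx hy).trans ht.1.le))
  unfold G2R
  rw [← mul_sub, abs_mul, abs_of_pos (by positivity)]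
  have : |h1 y + z * G1 δ z G H y - (h1 x + z * G1 δ z G H x)| ≤ 2 * |y - x| := by
    rw [show h1 y + z * G1 δ z G H y - (h1 x + z * G1 δ z G H x) =
      (h1 y - h1 x) + z * (G1 δ z G H y - G1 δ z G H x) by ring]
    refine (abs_add_le _ _).trans ?_
    rw [abs_mul, abs_of_pos hz]
    have h3 := mul_le_mul_of_nonneg_left h2 hz.le
    have e : z * (1 / z * |y - x|) = |y - x| := by field_simp
    linarith [hl y x]
  calc _ ≤ 2 / (2 + δ * z) * (2 * |y - x|) := mul_le_mul_of_nonneg_left this (by positivity)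
    _ = _ := by ring

noncomputable def KK (z : ℝ) : ℝ := 180 * (1 + 1 / z)

lemma KK_ge (hz : 0 < z) : 180 ≤ KK z := by
  unfold KK; have : 0 < 1 / z := by positivity
  linarith

lemma G1L_abs (S : SteinSol δ z G H p) {x : ℝ} (h : -(1/δ) ≤ x) (h2 : x ≤ z) :
    |G1 δ z G H x| ≤ 4 * KK z * (1 + |x|) := by
  have ha := a_pos S.hδ h
  have hz := S.hz
  have hG : |G x| ≤ KK z := S.left_abs h2
  have hH := S.abs_H_le x
  have h0 := S.H0_abs
  have hK := KK_ge hz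
  have hK2 : 4 + 1 / z ≤ KK z := by
    unfold KK; have : 0 < 1 / z := by positivity
    linarith
  have hx := abs_nonneg x
  rw [S.G1_left h h2, abs_mul, abs_of_pos (by positivity)]
  have h5 : |H x + x * G x| ≤ 2 * KK z * (1 + |x|) := by
    refine (abs_add_le _ _).trans ?_
    rw [abs_mul]
    nlinarith
  have h6 : 2 / (2 + δ * x) ≤ 2 := by rw [div_le_iff₀ (by linarith)]; linarith
  calc _ ≤ 2 * (2 * KK z * (1 + |x|)) := mul_le_mul h6 h5 (abs_nonneg _) (by norm_num)
    _ = _ := by ring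

lemma G2L_abs (S : SteinSol δ z G H p) (hb : ∀ x, |h1 x| ≤ 1) {x : ℝ} (h : -(1/δ) ≤ x) (h2 : x ≤ z) :
    |G2L δ z G H h1 x| ≤ 12 * KK z * (1 + |x|)^2 := by
  have ha := a_pos S.hδ h
  have hz := S.hz
  have hG : |G x| ≤ KK z := S.left_abs h2
  have hG1 := S.G1L_abs h h2
  have hK := KK_ge hz
  have hx := abs_nonneg x
  unfold G2L
  rw [abs_mul, abs_of_pos (by positivity)]
  have h5 : |h1 x + G x + (x - δ / 2) * G1 δ z G H x| ≤ 6 * KK z * (1 + |x|)^2 := by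
    refine (abs_add_le _ _).trans ?_
    have h6 := abs_add_le (h1 x) (G x)
    rw [abs_mul]
    have h7 : |x - δ / 2| ≤ |x| + 1 / 2 := by
      refine (abs_sub _ _).trans ?_
      rw [abs_of_pos (a := δ / 2) (by linarith [S.hδ])]; linarith [S.hδ1]
    have h8 := hb x
    have h9 : |x - δ / 2| * |G1 δ z G H x| ≤ (|x| + 1 / 2) * (4 * KK z * (1 + |x|)) :=
      mul_le_mul h7 hG1 (abs_nonneg _) (by positivity)
    nlinarith [mul_nonneg (by linarith : 0 ≤ KK z) hx, mul_nonneg (mul_nonneg (by linarith : 0 ≤ KK z) hx) hx]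
  have h6 : 2 / (2 + δ * x) ≤ 2 := by rw [div_le_iff₀ (by linarith)]; linarith
  calc _ ≤ 2 * (6 * KK z * (1 + |x|)^2) := mul_le_mul h6 h5 (abs_nonneg _) (by norm_num)
    _ = _ := by ring

set_option maxHeartbeats 1000000 in
lemma G2L_lip (S : SteinSol δ z G H p) (hh : ∀ x, HasDerivAt H (h1 x) x) (hb : ∀ x, |h1 x| ≤ 1)
    (hl : ∀ x y, |h1 x - h1 y| ≤ |x - y|) {x t : ℝ} (hx : x ∈ Icc (-(1/δ)) z)
    (ht : t ∈ Icc (-(1/δ)) z) (hxt : |t - x| ≤ δ / 2) :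
    |G2L δ z G H h1 t - G2L δ z G H h1 x| ≤ 80 * δ * KK z * (1 + |x|)^3 / (2 + δ * x) := by
  have ha := a_pos S.hδ hx.1
  have hat := a_pos S.hδ ht.1
  have hz := S.hz
  have hδ := S.hδ
  have hδ1 := S.hδ1
  have hK := KK_ge hz
  have hK0 : 0 ≤ KK z := by linarith
  have hx0 := abs_nonneg x
  set y := 1 + |x| with hy
  have hy1 : 1 ≤ y := by linarith
  have hseg : ∀ s ∈ Icc (min x t) (max x t), s ∈ Icc (-(1/δ)) z ∧ 1 + |s| ≤ 3/2 * y := by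
    intro s hs
    refine ⟨⟨(le_min hx.1 ht.1).trans hs.1, hs.2.trans (max_le hx.2 ht.2)⟩, ?_⟩
    have : |s - x| ≤ |t - x| := by
      have := abs_sub_left_of_mem_uIcc (a := x) (b := t) (c := s) (by rwa [uIcc])
      exact this
    have h3 := abs_sub_abs_le_abs_sub s x
    linarith
  have hseg' : ∀ s ∈ Ioo (min x t) (max x t), s ∈ Icc (-(1/δ)) z ∧ 1 + |s| ≤ 3/2 * y :=
    fun s hs => hseg s ⟨hs.1.le, hs.2.le⟩
  have htt := hseg t ⟨min_le_right _ _, le_max_right _ _⟩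
  have b1 : |G t - G x| ≤ 6 * KK z * y * |t - x| := by
    apply lip_of (f' := G1 δ z G H) S.G_cont (fun s _ => S.ode s)
    intro s hs
    refine (S.G1L_abs (hseg' s hs).1.1 (hseg' s hs).1.2).trans ?_
    have := (hseg' s hs).2
    nlinarith
  have b2 : |G1 δ z G H t - G1 δ z G H x| ≤ 27 * KK z * y^2 * |t - x| := by
    apply lip_of (f' := G2L δ z G H h1) S.G1_cont
    · intro s hs
      exact S.derL hh ⟨(le_min hx.1 ht.1).trans_lt hs.1, hs.2.trans_le (max_le hx.2 ht.2)⟩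
    intro s hs
    refine (S.G2L_abs hb (hseg' s hs).1.1 (hseg' s hs).1.2).trans ?_
    have h3 := (hseg' s hs).2
    have h4 : (1 + |s|)^2 ≤ (3/2*y)^2 := pow_le_pow_left₀ (by positivity) h3 2
    nlinarith
  have b3 := S.G1L_abs hx.1 hx.2
  have b4 : |G2L δ z G H h1 t| ≤ 27 * KK z * y^2 := by
    refine (S.G2L_abs hb htt.1.1 htt.1.2).trans ?_
    have h4 : (1 + |t|)^2 ≤ (3/2*y)^2 := pow_le_pow_left₀ (by positivity) htt.2 2
    nlinarith
  have b5 : |t - δ / 2| ≤ 3/2 * y := by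
    refine (abs_sub _ _).trans ?_
    rw [abs_of_pos (a := δ / 2) (by linarith [S.hδ])]; linarith [htt.2]
  have e1 : ∀ s, 1 ≤ 2 + δ * s →
      (2 + δ * s) * G2L δ z G H h1 s = 2 * (h1 s + G s + (s - δ / 2) * G1 δ z G H s) := by
    intro s hs; unfold G2L; field_simp
  have e2 : (2 + δ * x) * (G2L δ z G H h1 t - G2L δ z G H h1 x) =
      2 * (h1 t - h1 x) + 2 * (G t - G x) + 2 * ((t - δ/2) * (G1 δ z G H t - G1 δ z G H x))
      + 2 * ((t - x) * G1 δ z G H x) + -(δ * ((t - x) * G2L δ z G H h1 t)) := by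
    have := e1 t hat
    have := e1 x ha
    linear_combination e1 t hat - e1 x ha
  rw [le_div_iff₀ (by linarith)]
  have e3 : |G2L δ z G H h1 t - G2L δ z G H h1 x| * (2 + δ * x) =
      |(2 + δ * x) * (G2L δ z G H h1 t - G2L δ z G H h1 x)| := by
    rw [abs_mul, abs_of_pos (a := 2 + δ * x) (by linarith)]; ring
  rw [e3, e2]
  have c1 : |2 * (h1 t - h1 x)| ≤ 2 * |t - x| := by
    rw [abs_mul, abs_of_pos (a := (2:ℝ)) (by norm_num)]; linarith [hl t x]
  have c2 : |2 * (G t - G x)| ≤ 2 * (6 * KK z * y * |t - x|) := by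
    rw [abs_mul, abs_of_pos (a := (2:ℝ)) (by norm_num)]; linarith
  have c3 : |2 * ((t - δ/2) * (G1 δ z G H t - G1 δ z G H x))| ≤
      2 * ((3/2*y) * (27 * KK z * y^2 * |t - x|)) := by
    rw [abs_mul, abs_of_pos (a := (2:ℝ)) (by norm_num), abs_mul]
    exact mul_le_mul_of_nonneg_left (mul_le_mul b5 b2 (abs_nonneg _) (by positivity)) (by norm_num)
  have c4 : |2 * ((t - x) * G1 δ z G H x)| ≤ 2 * (|t - x| * (4 * KK z * y)) := by
    rw [abs_mul, abs_of_pos (a := (2:ℝ)) (by norm_num), abs_mul]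
    exact mul_le_mul_of_nonneg_left (mul_le_mul_of_nonneg_left b3 (abs_nonneg _)) (by norm_num)
  have c5 : |-(δ * ((t - x) * G2L δ z G H h1 t))| ≤ |t - x| * (27 * KK z * y^2) := by
    rw [abs_neg, abs_mul, abs_mul, abs_of_pos hδ]
    have := mul_le_mul_of_nonneg_left b4 (abs_nonneg (t - x))
    have h0 : 0 ≤ |t - x| * |G2L δ z G H h1 t| := by positivity
    nlinarith
  have tri : ∀ a b c d e : ℝ, |a + b + c + d + e| ≤ |a| + |b| + |c| + |d| + |e| := fun a b c d e => by
    linarith [abs_add_le (a+b+c+d) e, abs_add_le (a+b+c) d, abs_add_le (a+b) c, abs_add_le a b]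
  refine (tri _ _ _ _ _).trans ?_
  have q1 : (1:ℝ) ≤ KK z * y^3 := by
    have : 1 ≤ y^3 := one_le_pow₀ hy1
    nlinarith
  have q2 : KK z * y ≤ KK z * y^3 := mul_le_mul_of_nonneg_left (by nlinarith [sq_nonneg y, mul_self_nonneg (y-1)]) hK0
  have q3 : KK z * y^2 ≤ KK z * y^3 := mul_le_mul_of_nonneg_left (by nlinarith [sq_nonneg y]) hK0
  have q4 : 2 + 12 * (KK z * y) + 81 * (KK z * y^3) + 8 * (KK z * y) + 27 * (KK z * y^2) ≤ 160 * (KK z * y^3) := by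
    linarith
  calc _ ≤ |t - x| * (2 + 12 * (KK z * y) + 81 * (KK z * y^3) + 8 * (KK z * y) + 27 * (KK z * y^2)) := by
        linarith
    _ ≤ (δ / 2) * (160 * (KK z * y^3)) := by
        apply mul_le_mul hxt q4 (by positivity) (by positivity)
    _ = _ := by ring

end SteinSol


namespace SteinSol
variable {δ z : ℝ} {G H p h1 : ℝ → ℝ}

lemma err_alg {δ R d Hx g g1 gp gm c1 c2 M1 M2 : ℝ} (hδ : 0 < δ) (hR : 0 ≤ R) (hd : 0 ≤ d)
    (hH : Hx = δ * (R - d) * g + δ^2 * (R + d) / 2 * g1)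
    (h1 : |gp - g - δ / 2 * g1 - (δ / 2)^2 / 2 * c1| ≤ M1 * (δ / 2)^2)
    (h2 : d = 0 ∨ |gm - g + δ / 2 * g1 - (δ / 2)^2 / 2 * c2| ≤ M2 * (δ / 2)^2) :
    |Hx - δ * (R * gp - d * gm)| ≤ δ^3 / 8 * |R * c1 - d * c2| + δ^3 / 4 * (R * M1 + d * M2) := by
  set T1 := gp - g - δ / 2 * g1 - (δ / 2)^2 / 2 * c1 with hT1
  set T2 := gm - g + δ / 2 * g1 - (δ / 2)^2 / 2 * c2 with hT2
  have h2' : d * |T2| ≤ d * (M2 * (δ / 2)^2) := by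
    rcases h2 with h2 | h2
    · simp [h2]
    · exact mul_le_mul_of_nonneg_left h2 hd
  have h1' := mul_le_mul_of_nonneg_left h1 hR
  have e : Hx - δ * (R * gp - d * gm) = -(δ^3 / 8 * (R * c1 - d * c2)) + (-(δ * (R * T1)) + δ * (d * T2)) := by
    rw [hH, hT1, hT2]; ring
  rw [e]
  refine (abs_add_le _ _).trans ?_
  rw [abs_neg, abs_mul, abs_of_pos (by positivity : 0 < δ^3 / 8)]
  have h3 := abs_add_le (-(δ * (R * T1))) (δ * (d * T2))
  rw [abs_neg, abs_mul, abs_mul, abs_mul, abs_mul, abs_of_pos hδ, abs_of_nonneg hR, abs_of_nonneg hd] at h3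
  have h4 := mul_le_mul_of_nonneg_left h2' hδ.le
  have h5 := mul_le_mul_of_nonneg_left h1' hδ.le
  nlinarith

lemma taylor_up_L (S : SteinSol δ z G H p) (hh : ∀ x, HasDerivAt H (h1 x) x) (hb : ∀ x, |h1 x| ≤ 1)
    (hl : ∀ x y, |h1 x - h1 y| ≤ |x - y|) {x : ℝ} (hx : -(1/δ) ≤ x) (hx2 : x + δ / 2 ≤ z) :
    |G (x + δ/2) - G x - δ / 2 * G1 δ z G H x - (δ / 2)^2 / 2 * G2L δ z G H h1 x|
      ≤ 80 * δ * KK z * (1 + |x|)^3 / (2 + δ * x) * (δ / 2)^2 := by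
  have hδ := S.hδ
  have := taylor_right (f := G) (f1 := G1 δ z G H) (f2 := G2L δ z G H h1) (x := x) (y := x + δ/2)
    (c := G2L δ z G H h1 x) (M := 80 * δ * KK z * (1 + |x|)^3 / (2 + δ * x)) (by linarith)
    (fun t _ => S.ode t) S.G1_cont.continuousOn
    (fun t ht => S.derL hh ⟨by linarith [ht.1], by linarith [ht.2]⟩)
    (fun t ht => S.G2L_lip hh hb hl ⟨hx, by linarith⟩ ⟨by linarith [ht.1], by linarith [ht.2]⟩
      (by rw [abs_of_pos (by linarith [ht.1])]; linarith [ht.2]))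
  rwa [add_sub_cancel_left] at this

lemma taylor_down_L (S : SteinSol δ z G H p) (hh : ∀ x, HasDerivAt H (h1 x) x) (hb : ∀ x, |h1 x| ≤ 1)
    (hl : ∀ x y, |h1 x - h1 y| ≤ |x - y|) {x : ℝ} (hx : -(1/δ) ≤ x - δ / 2) (hx2 : x ≤ z) :
    |G (x - δ/2) - G x + δ / 2 * G1 δ z G H x - (δ / 2)^2 / 2 * G2L δ z G H h1 x|
      ≤ 80 * δ * KK z * (1 + |x|)^3 / (2 + δ * x) * (δ / 2)^2 := by
  have hδ := S.hδ
  have := taylor_left (f := G) (f1 := G1 δ z G H) (f2 := G2L δ z G H h1) (x := x - δ/2) (y := x)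
    (c := G2L δ z G H h1 x) (M := 80 * δ * KK z * (1 + |x|)^3 / (2 + δ * x)) (by linarith)
    (fun t _ => S.ode t) S.G1_cont.continuousOn
    (fun t ht => S.derL hh ⟨by linarith [ht.1], by linarith [ht.2]⟩)
    (fun t ht => S.G2L_lip hh hb hl ⟨by linarith, by linarith⟩ ⟨by linarith [ht.1], by linarith [ht.2]⟩
      (by rw [abs_sub_comm, abs_of_pos (by linarith [ht.2])]; linarith [ht.1]))
  rwa [sub_sub_cancel] at this

lemma taylor_up_R (S : SteinSol δ z G H p) (hh : ∀ x, HasDerivAt H (h1 x) x)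
    (hl : ∀ x y, |h1 x - h1 y| ≤ |x - y|) {x : ℝ} (hx : z ≤ x) :
    |G (x + δ/2) - G x - δ / 2 * G1 δ z G H x - (δ / 2)^2 / 2 * G2R δ z G H h1 x|
      ≤ 2 * δ / (2 + δ * z) * (δ / 2)^2 := by
  have hδ := S.hδ
  have hz := S.hz
  have := taylor_right (f := G) (f1 := G1 δ z G H) (f2 := G2R δ z G H h1) (x := x) (y := x + δ/2)
    (c := G2R δ z G H h1 x) (M := 2 * δ / (2 + δ * z)) (by linarith)
    (fun t _ => S.ode t) S.G1_cont.continuousOn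
    (fun t ht => S.derR hh (by linarith [ht.1]))
    (fun t ht => by
      refine (S.G2R_lip hh hl hx (by linarith [ht.1])).trans ?_
      rw [abs_of_pos (by linarith [ht.1])]
      calc _ ≤ 4 / (2 + δ * z) * (δ / 2) := 
            mul_le_mul_of_nonneg_left (by linarith [ht.2]) (by positivity)
        _ = _ := by ring)
  rwa [add_sub_cancel_left] at this

lemma taylor_down_R (S : SteinSol δ z G H p) (hh : ∀ x, HasDerivAt H (h1 x) x)
    (hl : ∀ x y, |h1 x - h1 y| ≤ |x - y|) {x : ℝ} (hx : z ≤ x - δ / 2) :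
    |G (x - δ/2) - G x + δ / 2 * G1 δ z G H x - (δ / 2)^2 / 2 * G2R δ z G H h1 x|
      ≤ 2 * δ / (2 + δ * z) * (δ / 2)^2 := by
  have hδ := S.hδ
  have hz := S.hz
  have := taylor_left (f := G) (f1 := G1 δ z G H) (f2 := G2R δ z G H h1) (x := x - δ/2) (y := x)
    (c := G2R δ z G H h1 x) (M := 2 * δ / (2 + δ * z)) (by linarith)
    (fun t _ => S.ode t) S.G1_cont.continuousOn
    (fun t ht => S.derR hh (by linarith [ht.1]))
    (fun t ht => by
      refine (S.G2R_lip hh hl (by linarith) (by linarith [ht.1])).trans ?_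
      rw [abs_sub_comm, abs_of_pos (by linarith [ht.2])]
      calc _ ≤ 4 / (2 + δ * z) * (δ / 2) := 
            mul_le_mul_of_nonneg_left (by linarith [ht.1]) (by positivity)
        _ = _ := by ring)
  rwa [sub_sub_cancel] at this

lemma err_left (S : SteinSol δ z G H p) (hh : ∀ x, HasDerivAt H (h1 x) x) (hb : ∀ x, |h1 x| ≤ 1)
    (hl : ∀ x y, |h1 x - h1 y| ≤ |x - y|) {x R d : ℝ} (hx : -(1/δ) ≤ x) (hx2 : x + δ / 2 ≤ z)
    (hR : R * δ^2 = 1) (hd0 : 0 ≤ d) (hd : δ * (R - d) = -x) (hd1 : d = 0 ∨ -(1/δ) ≤ x - δ/2) :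
    |H x - δ * (R * G (x + δ/2) - d * G (x - δ/2))| ≤ 22 * δ^2 * KK z * (1 + |x|)^3 := by
  have hδ := S.hδ
  have hz := S.hz
  have ha := a_pos hδ hx
  have hK := KK_ge hz
  have hK0 : 0 ≤ KK z := by linarith
  have hR0 : 0 ≤ R := by
    by_contra! hc
    nlinarith [mul_pos (neg_pos.2 hc) (pow_pos hδ 2)]
  have hsum : δ^2 * (R + d) = 2 + δ * x := by
    have : δ * (δ * (R - d)) = δ * (-x) := by rw [hd]
    nlinarith
  have := err_alg (Hx := H x) (g := G x) (g1 := G1 δ z G H x) hδ hR0 hd0 (by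
      have ha' : 2 + δ * x ≠ 0 := by linarith
      rw [hd, hsum, S.G1_left hx (by linarith)]
      generalize 2 + δ * x = a at ha'
      field_simp; ring)
    (S.taylor_up_L hh hb hl hx hx2)
    (hd1.imp id (fun h => S.taylor_down_L hh hb hl h (by linarith)))
  refine this.trans ?_
  set c := G2L δ z G H h1 x
  have hc : |c| ≤ 12 * KK z * (1 + |x|)^2 := S.G2L_abs hb hx (by linarith)
  have e1 : δ^3 / 8 * |R * c - d * c| = δ^2 / 8 * (|x| * |c|) := by
    have : δ^3 / 8 * |R * c - d * c| = δ^2 / 8 * (|δ * (R - d)| * |c|) := by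
      rw [← sub_mul, abs_mul, abs_mul, abs_of_pos hδ]; ring
    rw [this, hd, abs_neg]
  set M := 80 * δ * KK z * (1 + |x|)^3 with hM
  have e2 : δ^3 / 4 * (R * (M / (2 + δ * x)) + d * (M / (2 + δ * x))) = 20 * δ^2 * KK z * (1 + |x|)^3 := by
    have : δ^3 / 4 * (R * (M / (2 + δ * x)) + d * (M / (2 + δ * x))) = 
      δ / 4 * (δ^2 * (R + d)) * (M / (2 + δ * x)) := by ring
    rw [this, hsum, hM]; field_simp; ring
  rw [e1, e2]
  have e3 : |x| * |c| ≤ (1 + |x|) * (12 * KK z * (1 + |x|)^2) :=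
    mul_le_mul (by linarith) hc (abs_nonneg _) (by positivity)
  have e4 : 0 ≤ δ^2 * KK z * (1 + |x|)^3 := by positivity
  have e5 := mul_le_mul_of_nonneg_left e3 (by positivity : 0 ≤ δ^2/8)
  nlinarith

lemma err_right (S : SteinSol δ z G H p) (hh : ∀ x, HasDerivAt H (h1 x) x)
    (hl : ∀ x y, |h1 x - h1 y| ≤ |x - y|) {x R d : ℝ} (hx : z ≤ x - δ / 2)
    (hR : R * δ^2 = 1) (hd0 : 0 ≤ d) (hd : δ * (R - d) = -z) :
    |H x - δ * (R * G (x + δ/2) - d * G (x - δ/2))| ≤ δ^2 := by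
  have hδ := S.hδ
  have hz := S.hz
  have hR0 : 0 ≤ R := by
    by_contra! hc
    nlinarith [mul_pos (neg_pos.2 hc) (pow_pos hδ 2)]
  have hsum : δ^2 * (R + d) = 2 + δ * z := by
    have : δ * (δ * (R - d)) = δ * (-z) := by rw [hd]
    nlinarith
  have := err_alg (Hx := H x) (g := G x) (g1 := G1 δ z G H x) hδ hR0 hd0 (by
      rw [hd, hsum, S.G1_right (by linarith)]; field_simp; ring)
    (S.taylor_up_R hh hl (by linarith))
    (Or.inr (S.taylor_down_R hh hl hx))
  refine this.trans ?_
  set c := G2R δ z G H h1 x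
  have hc : |c| ≤ 1 / z := S.G2R_abs hh hl (by linarith)
  have e1 : δ^3 / 8 * |R * c - d * c| = δ^2 / 8 * (z * |c|) := by
    have : δ^3 / 8 * |R * c - d * c| = δ^2 / 8 * (|δ * (R - d)| * |c|) := by
      rw [← sub_mul, abs_mul, abs_mul, abs_of_pos hδ]; ring
    rw [this, hd, abs_neg, abs_of_pos hz]
  have e2 : δ^3 / 4 * (R * (2 * δ / (2 + δ * z)) + d * (2 * δ / (2 + δ * z))) = δ^2 / 2 := by
    have : δ^3 / 4 * (R * (2 * δ / (2 + δ * z)) + d * (2 * δ / (2 + δ * z))) = 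
      δ / 4 * (δ^2 * (R + d)) * (2 * δ / (2 + δ * z)) := by ring
    rw [this, hsum]; field_simp; norm_num
  rw [e1, e2]
  have e3 : z * |c| ≤ 1 := by
    calc z * |c| ≤ z * (1 / z) := mul_le_mul_of_nonneg_left hc hz.le
      _ = 1 := by field_simp
  nlinarith [pow_pos hδ 2]

lemma err_mid (S : SteinSol δ z G H p) (hh : ∀ x, HasDerivAt H (h1 x) x) (hb : ∀ x, |h1 x| ≤ 1)
    (hl : ∀ x y, |h1 x - h1 y| ≤ |x - y|) {R d : ℝ} 
    (hR : R * δ^2 = 1) (hd0 : 0 ≤ d) (hd : δ * (R - d) = -z) (hd1 : -(1/δ) ≤ z - δ/2) :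
    |H z - δ * (R * G (z + δ/2) - d * G (z - δ/2))| ≤
      22 * δ^2 * KK z * (1 + |z|)^3 + δ^2 + δ * KK z := by
  have hδ := S.hδ
  have hz := S.hz
  have hx : -(1/δ) ≤ z := by linarith
  have ha := a_pos hδ hx
  have hK := KK_ge hz
  have hK0 : 0 ≤ KK z := by linarith
  have hR0 : 0 ≤ R := by
    by_contra! hc
    nlinarith [mul_pos (neg_pos.2 hc) (pow_pos hδ 2)]
  have hsum : δ^2 * (R + d) = 2 + δ * z := by
    have : δ * (δ * (R - d)) = δ * (-z) := by rw [hd]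
    nlinarith
  have := err_alg (Hx := H z) (g := G z) (g1 := G1 δ z G H z) hδ hR0 hd0 (by
      rw [hd, hsum, S.G1_left hx le_rfl]; field_simp; ring)
    (S.taylor_up_R hh hl le_rfl)
    (Or.inr (S.taylor_down_L hh hb hl hd1 le_rfl))
  refine this.trans ?_
  set c := G2L δ z G H h1 z with hcdef
  set c' := G2R δ z G H h1 z with hcdef'
  have hc : |c| ≤ 12 * KK z * (1 + |z|)^2 := S.G2L_abs hb hx le_rfl
  have hjump : |c' - c| ≤ 2 * KK z := by
    have e : c' - c = 2 / (2 + δ * z) * (δ / 2 * G1 δ z G H z - G z) := by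
      rw [hcdef, hcdef']; unfold G2L G2R; ring
    have h1 : |G1 δ z G H z| ≤ 1 / z := S.G1R_abs le_rfl
    have h2 : |G z| ≤ KK z := S.left_abs le_rfl
    have h3 : 1 / z ≤ KK z := by
      unfold KK; have : 0 < 1 / z := by positivity
      linarith
    have h4 : 2 / (2 + δ * z) ≤ 1 := by
      rw [div_le_one (by positivity)]; nlinarith [mul_pos hδ hz]
    rw [e, abs_mul, abs_of_pos (by positivity)]
    have h5 : |δ / 2 * G1 δ z G H z - G z| ≤ 2 * KK z := by
      refine (abs_sub _ _).trans ?_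
      rw [abs_mul, abs_of_pos (by positivity : 0 < δ / 2)]
      nlinarith [S.hδ1, abs_nonneg (G1 δ z G H z)]
    calc _ ≤ 1 * (2 * KK z) := mul_le_mul h4 h5 (abs_nonneg _) (by norm_num)
      _ = _ := by ring
  have e1 : δ^3 / 8 * |R * c' - d * c| ≤ δ^2 / 8 * (|z| * |c|) + δ / 8 * |c' - c| := by
    have e : R * c' - d * c = (R - d) * c + R * (c' - c) := by ring
    have t := abs_add_le ((R - d) * c) (R * (c' - c))
    rw [← e] at t
    have t2 := mul_le_mul_of_nonneg_left t (by positivity : 0 ≤ δ^3 / 8)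
    refine t2.trans (le_of_eq ?_)
    rw [abs_mul, abs_mul, abs_of_nonneg hR0]
    have : |z| = δ * |R - d| := by
      rw [← abs_of_pos hδ, ← abs_mul, hd, abs_neg]
    rw [this]
    linear_combination δ / 8 * |c' - c| * hR
  set M := 80 * δ * KK z * (1 + |z|)^3 with hM
  have hM0 : 0 ≤ M := by positivity
  have hMM : 0 ≤ M / (2 + δ * z) := by positivity
  have e2 : δ^3 / 4 * (R * (2 * δ / (2 + δ * z)) + d * (M / (2 + δ * z))) ≤
      δ^2 + 20 * δ^2 * KK z * (1 + |z|)^3 := by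
    have e : δ^3 / 4 * (R * (2 * δ / (2 + δ * z)) + d * (M / (2 + δ * z))) ≤
      δ / 4 * (R * δ^2) * (2 * δ / (2 + δ * z)) + δ / 4 * (δ^2 * (R + d)) * (M / (2 + δ * z)) := by
      have : 0 ≤ δ^3 / 4 * R * (M / (2 + δ * z)) := by positivity
      nlinarith
    refine e.trans ?_
    rw [hR, hsum]
    have e3 : δ / 4 * (2 + δ * z) * (M / (2 + δ * z)) = 20 * δ^2 * KK z * (1 + |z|)^3 := by
      rw [hM]; field_simp; ring
    have e4 : δ / 4 * 1 * (2 * δ / (2 + δ * z)) ≤ δ^2 := by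
      have : 2 * δ / (2 + δ * z) ≤ δ := by
        rw [div_le_iff₀ (by positivity)]; nlinarith [mul_pos hδ (mul_pos hδ hz)]
      nlinarith
    rw [e3]; linarith
  have e3 : |z| * |c| ≤ (1 + |z|) * (12 * KK z * (1 + |z|)^2) :=
    mul_le_mul (by linarith) hc (abs_nonneg _) (by positivity)
  have e4 : 0 ≤ δ^2 * KK z * (1 + |z|)^3 := by positivity
  have e5 := mul_le_mul_of_nonneg_left e3 (by positivity : 0 ≤ δ^2/8)
  have e6 := mul_le_mul_of_nonneg_left hjump (by positivity : 0 ≤ δ/8)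
  have e7 : 0 ≤ δ * KK z := by positivity
  nlinarith

end SteinSol


structure ErlangPi (R δ z : ℝ) (n : ℕ) (π : ℕ → ℝ) : Prop where
  hδ : 0 < δ
  hδ1 : δ ≤ 1
  hR : R * δ^2 = 1
  hz : z = δ * (n - R)
  hz0 : 0 < z
  nonneg : ∀ k, 0 ≤ π k
  summ : Summable π
  tot : ∑' k, π k = 1
  bal : ∀ k : ℕ, R * π k = min ((k:ℝ) + 1) n * π (k + 1)

namespace ErlangPi
variable {R δ z : ℝ} {n : ℕ} {π : ℕ → ℝ}

lemma R_pos (S : ErlangPi R δ z n π) : 0 < R := by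
  by_contra! hc
  have := S.hR
  nlinarith [mul_nonneg (neg_nonneg.2 hc) (pow_pos S.hδ 2).le]

lemma Rlt (S : ErlangPi R δ z n π) : R < n := by
  have h1 := S.hz0
  rw [S.hz] at h1
  have := pos_of_mul_pos_right h1 S.hδ.le
  linarith

lemma tele (S : ErlangPi R δ z n π) (g : ℕ → ℝ) (N : ℕ) :
    ∑ k ∈ Finset.range N, π k * (R * g (k + 1) - min (k:ℝ) n * g k) = min (N:ℝ) n * π N * g N := by
  induction N with
  | zero => simp
  | succ N ih =>
    rw [Finset.sum_range_succ, ih]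
    have := S.bal N
    push_cast
    linear_combination g (N + 1) * this

lemma tele_n (S : ErlangPi R δ z n π) (g : ℕ → ℝ) :
    ∑ k ∈ Finset.range n, π k * (R * g (k + 1) - k * g k) = n * π n * g n := by
  have := S.tele g n
  rw [min_self] at this
  rw [← this]
  apply Finset.sum_congr rfl
  intro k hk
  rw [min_eq_left]
  exact_mod_cast (Finset.mem_range.1 hk).le

lemma sum_le_one (S : ErlangPi R δ z n π) (s : Finset ℕ) : ∑ k ∈ s, π k ≤ 1 := by
  rw [← S.tot]; exact S.summ.sum_le_tsum s (fun k _ => S.nonneg k)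

lemma npi_le (S : ErlangPi R δ z n π) : n * π n ≤ n - R := by
  have hlim : Tendsto (fun N => n - R + n * π N) atTop (𝓝 (n - R + n * 0)) :=
    (S.summ.tendsto_atTop_zero.const_mul _).const_add _
  rw [mul_zero, add_zero] at hlim
  have hRn := S.Rlt
  apply ge_of_tendsto hlim
  filter_upwards [eventually_ge_atTop n] with N hN
  obtain ⟨M, rfl⟩ := Nat.exists_eq_add_of_le hN
  have h1 := S.tele (fun _ => 1) (n + M)
  have h2 := S.tele_n (fun _ => 1)
  rw [Finset.sum_range_add] at h1
  have e1 : ∑ k ∈ Finset.range n, π k * (R * 1 - min (k:ℝ) n * 1) = n * π n * 1 := by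
    rw [← h2]
    apply Finset.sum_congr rfl
    intro k hk
    rw [min_eq_left]
    exact_mod_cast (Finset.mem_range.1 hk).le
  have e2 : ∑ k ∈ Finset.range M, π (n + k) * (R * 1 - min ((n + k : ℕ):ℝ) n * 1) =
      (R - n) * ∑ k ∈ Finset.range M, π (n + k) := by
    rw [Finset.mul_sum]
    apply Finset.sum_congr rfl
    intro k hk
    rw [min_eq_right (by push_cast; linarith [(Nat.cast_nonneg k : (0:ℝ) ≤ k)])]
    ring
  rw [e1, e2, min_eq_right (by exact_mod_cast hN)] at h1
  have h3 : ∑ k ∈ Finset.range M, π (n + k) ≤ 1 := by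
    have := S.sum_le_one (Finset.range (n + M))
    rw [Finset.sum_range_add] at this
    have : 0 ≤ ∑ k ∈ Finset.range n, π k := Finset.sum_nonneg (fun k _ => S.nonneg k)
    linarith
  nlinarith

set_option maxHeartbeats 2000000 in
/-- key moment bounds -/
lemma moments (S : ErlangPi R δ z n π) :
    ∃ P : ℝ, 0 ≤ P ∧ P ≤ 1 ∧ P ≤ 18 * z ∧ π n ≤ δ * P ∧
      ∑ k ∈ Finset.range n, π k * (1 + (δ * (k - R))^4) + π n * (1 + z^4) ≤ 6 * P := by
  have hδ := S.hδ
  have hδ1 := S.hδ1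
  have hz0 := S.hz0
  have hR := S.hR
  have hRp := S.R_pos
  have hzn : δ * ((n:ℝ) - R) = z := S.hz.symm
  set X : ℕ → ℝ := fun k => δ * (k - R) with hX
  have hXn : X n = z := hzn
  have hXs : ∀ k, X (k + 1) = X k + δ := fun k => by simp only [hX]; push_cast; ring
  have hk : ∀ k : ℕ, δ * (k:ℝ) = δ * R + X k := fun k => by simp only [hX]; ring
  set P := ∑ k ∈ Finset.range n, π k with hP
  set S1 := ∑ k ∈ Finset.range n, π k * X k with hS1
  set S2 := ∑ k ∈ Finset.range n, π k * X k ^ 2 with hS2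
  set S4 := ∑ k ∈ Finset.range n, π k * X k ^ 4 with hS4
  set Sa := ∑ k ∈ Finset.range n, π k * |X k| with hSa
  set Q := δ * (n * π n) with hQ
  have hn0 := S.nonneg n
  have hQ0 : 0 ≤ Q := by positivity
  have hP0 : 0 ≤ P := Finset.sum_nonneg (fun k _ => S.nonneg k)
  have hP1 : P ≤ 1 := S.sum_le_one _
  have hSa0 : 0 ≤ Sa := Finset.sum_nonneg (fun k _ => mul_nonneg (S.nonneg k) (abs_nonneg _))
  have hS40 : 0 ≤ S4 := Finset.sum_nonneg (fun k _ => mul_nonneg (S.nonneg k) (by positivity))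
  have i1 : -S1 = Q := by
    rw [hQ, ← mul_one (n * π n), ← S.tele_n (fun _ => 1), hS1, Finset.mul_sum, ← Finset.sum_neg_distrib]
    apply Finset.sum_congr rfl
    intro k _
    linear_combination π k * hk k
  have i2 : P - S2 = Q * z := by
    have := S.tele_n X
    rw [hXn] at this
    rw [hQ, mul_assoc, ← this, hP, hS2, Finset.mul_sum, ← Finset.sum_sub_distrib]
    apply Finset.sum_congr rfl
    intro k _
    rw [hXs]
    linear_combination π k * X k * hk k - π k * hR
  have i4 : 3 * S2 + 3 * δ * S1 + δ^2 * P - S4 = Q * z^3 := by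
    have := S.tele_n (fun k => X k ^ 3)
    rw [hXn] at this
    have e : Q * z^3 = δ * (n * π n * z^3) := by rw [hQ]; ring
    rw [e, ← this, hP, hS2, hS1, hS4, Finset.mul_sum, Finset.mul_sum, Finset.mul_sum, Finset.mul_sum,
      ← Finset.sum_add_distrib, ← Finset.sum_add_distrib, ← Finset.sum_sub_distrib]
    apply Finset.sum_congr rfl
    intro k _
    rw [hXs]
    linear_combination π k * X k^3 * hk k - π k * (3 * X k^2 + 3 * X k * δ + δ^2) * hR
  have j1 : Sa ≤ (P + S2) / 2 := by
    have : 2 * Sa ≤ P + S2 := by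
      rw [hSa, hP, hS2, Finset.mul_sum, ← Finset.sum_add_distrib]
      apply Finset.sum_le_sum
      intro k _
      have := S.nonneg k
      have h2 : 2 * |X k| ≤ 1 + X k ^2 := by nlinarith [sq_abs (X k), sq_nonneg (|X k| - 1)]
      nlinarith
    linarith
  have j2 : -S1 ≤ Sa := by
    rw [hS1, hSa, ← Finset.sum_neg_distrib]
    apply Finset.sum_le_sum
    intro k _
    nlinarith [S.nonneg k, neg_abs_le (X k)]
  have j3 : Sa ≤ 2 * z * P - S1 := by
    rw [hS1, hSa, hP, Finset.mul_sum, ← Finset.sum_sub_distrib]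
    apply Finset.sum_le_sum
    intro k hk
    have h1 : X k ≤ z := by
      rw [← hXn]
      have : (k:ℝ) ≤ n := by exact_mod_cast (Finset.mem_range.1 hk).le
      simp only [hX]; nlinarith
    have h2 : |X k| ≤ 2 * z - X k := abs_le.2 ⟨by linarith, by linarith⟩
    nlinarith [S.nonneg k]
  have j4 : S2 ≤ 3 * Sa + S4 / 9 := by
    have : 9 * S2 ≤ 27 * Sa + S4 := by
      rw [hS2, hSa, hS4, Finset.mul_sum, Finset.mul_sum, ← Finset.sum_add_distrib]
      apply Finset.sum_le_sum
      intro k _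
      have h2 : 9 * X k^2 ≤ 27 * |X k| + X k ^ 4 := by
        have e1 : X k ^ 2 = |X k|^2 := (sq_abs _).symm
        have e2 : X k ^ 4 = |X k|^4 := by rw [show (4:ℕ) = 2 * 2 by rfl, pow_mul, pow_mul, e1]
        rw [e1, e2]
        have h0 := abs_nonneg (X k)
        set y := |X k|
        have : 0 ≤ 27 - 9 * y + y^3 := by
          nlinarith [mul_nonneg h0 (sq_nonneg (y - 2)), sq_nonneg (y - 2)]
        nlinarith
      nlinarith [S.nonneg k]
    linarith
  have hQz : Q ≤ z := by
    rw [hQ, ← hzn]; exact mul_le_mul_of_nonneg_left S.npi_le hδ.le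
  have hQzn : 0 ≤ Q * z := mul_nonneg hQ0 hz0.le
  have hS2P : S2 ≤ P := by linarith
  have hQP : Q ≤ P := by linarith
  have hQ1 : Q * z ≤ z := by
    have := mul_le_mul_of_nonneg_right (hQP.trans hP1) hz0.le
    linarith
  have hzP : z * P ≤ z := by
    have := mul_le_mul_of_nonneg_left hP1 hz0.le
    linarith
  have hz3 : 0 ≤ Q * z^3 := by positivity
  have hS4Q : S4 + Q * z^3 ≤ 4 * P := by
    have a1 : 3 * δ * S1 ≤ 0 := by
      have := mul_nonneg hδ.le hQ0
      rw [← i1] at this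
      linarith
    have a2 : δ^2 * P ≤ 1 * P := mul_le_mul_of_nonneg_right (pow_le_one₀ hδ.le hδ1) hP0
    linarith
  have hδn : δ * n = δ * R + z := by rw [← hzn]; ring
  have hπ : π n ≤ δ * Q := by
    have : δ * Q = π n * (1 + δ * z) := by
      rw [hQ]
      linear_combination (δ * π n) * hδn + π n * hR
    have h3 := mul_nonneg hn0 (mul_pos hδ hz0).le
    linarith
  have hπz : π n * z ≤ Q := by
    have : Q = π n * (δ * R) + π n * z := by
      rw [hQ]; linear_combination π n * hδn
    have : 0 ≤ π n * (δ * R) := by positivity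
    linarith
  refine ⟨P, hP0, hP1, ?_, ?_, ?_⟩
  · have hS4' : S4 ≤ 4 * P := by linarith
    have e2 : 2 * z * P = 2 * (z * P) := by ring
    linarith
  · exact hπ.trans (mul_le_mul_of_nonneg_left hQP hδ.le)
  · have e : ∑ k ∈ Finset.range n, π k * (1 + (δ * (k - R))^4) = P + S4 := by
      rw [hP, ← Finset.sum_add_distrib]
      apply Finset.sum_congr rfl
      intro k _
      simp only [hX]; ring
    rw [e]
    have h1 : π n * z * z^3 ≤ Q * z^3 := mul_le_mul_of_nonneg_right hπz (by positivity)
    have h2 : π n * z * z^3 = π n * z^4 := by ring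
    have h3 : π n ≤ P := by
      have := mul_le_mul_of_nonneg_right hδ1 hQ0
      linarith
    linarith

lemma geom (S : ErlangPi R δ z n π) (j : ℕ) : π (n + j) = π n * (R / n)^j := by
  have hn : (0:ℝ) < n := S.R_pos.trans S.Rlt
  induction j with
  | zero => simp
  | succ j ih =>
    have := S.bal (n + j)
    rw [min_eq_right (by push_cast; linarith [(Nat.cast_nonneg j : (0:ℝ) ≤ j)])] at this
    rw [← add_assoc, pow_succ, ← mul_assoc, ← ih]
    field_simp
    linarith

end ErlangPi

open SteinSol in
theorem discrete_main {R δ z : ℝ} {n : ℕ} {π : ℕ → ℝ} {G H p h1 : ℝ → ℝ} 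
    (E : ErlangPi R δ z n π) (S : SteinSol δ z G H p)
    (hh : ∀ x, HasDerivAt H (h1 x) x) (hb : ∀ x, |h1 x| ≤ 1)
    (hl : ∀ x y, |h1 x - h1 y| ≤ |x - y|)
    (hs : Summable fun k : ℕ => π k * H (δ * (k - R))) :
    |∑' k : ℕ, π k * H (δ * (k - R))| ≤ 4000000 * δ^2 := by
  have hδ := S.hδ
  have hδ1 := S.hδ1
  have hz := S.hz
  have hR := E.hR
  have hRp := E.R_pos
  have hRn := E.Rlt
  have hn : (0:ℝ) < n := hRp.trans hRn
  have hzn : δ * ((n:ℝ) - R) = z := E.hz.symm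
  have hK := KK_ge hz
  set K := KK z with hKdef
  obtain ⟨P, hP0, hP1, hPz, hπn, hmom⟩ := E.moments
  set X : ℕ → ℝ := fun k => δ * (k - R) with hX
  set err : ℕ → ℝ := fun k => H (X k) - δ * (R * G (X k + δ/2) - min (k:ℝ) n * G (X k - δ/2)) with herr
  have hX0 : ∀ k : ℕ, X k = δ * k - 1 / δ := fun k => by
    simp only [hX]
    have : δ * R = 1 / δ := by field_simp; linarith
    rw [mul_sub, this]
  have hpow : ∀ x : ℝ, (1 + |x|)^3 ≤ 8 * (1 + x^4) := fun x => by
    have e2 : x ^ 4 = |x|^4 := by rw [show (4:ℕ) = 2 * 2 by rfl, pow_mul, pow_mul, sq_abs]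
    rw [e2]
    have h0 := abs_nonneg x
    set y := |x|
    nlinarith [sq_nonneg (y^2 - 1), sq_nonneg (y - 1), mul_nonneg h0 (sq_nonneg (y-1)), sq_nonneg y, mul_nonneg h0 h0, sq_nonneg (y^2 - y)]
  have b1 : ∀ k < n, |err k| ≤ 176 * δ^2 * K * (1 + X k ^ 4) := by
    intro k hk
    have hk' : (k:ℝ) + 1 ≤ n := by exact_mod_cast hk
    have hk0 : (0:ℝ) ≤ k := Nat.cast_nonneg k
    have := S.err_left hh hb hl (x := X k) (R := R) (d := k)
      (by rw [hX0]; nlinarith) (by simp only [hX]; rw [← hzn]; nlinarith) hR hk0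
      (by simp only [hX]; ring) (by
        rcases Nat.eq_zero_or_pos k with h | h
        · left; exact_mod_cast h
        · right
          have : (1:ℝ) ≤ k := by exact_mod_cast h
          rw [hX0]; nlinarith)
    simp only [herr]
    rw [min_eq_left (by linarith)]
    refine this.trans ?_
    calc _ ≤ 22 * δ^2 * KK z * (8 * (1 + X k ^4)) := 
          mul_le_mul_of_nonneg_left (hpow _) (by positivity)
      _ = _ := by rw [hKdef]; ring
  have b2 : |err n| ≤ 176 * δ^2 * K * (1 + z ^ 4) + δ^2 + δ * K := by
    have hXn : X n = z := hzn
    have := S.err_mid hh hb hl (R := R) (d := n) hR hn.le (by rw [← hzn]; ring) (by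
      have : 0 < 1 / δ := by positivity
      have : 1 ≤ 1 / δ := by rw [le_div_iff₀ hδ]; linarith
      linarith)
    simp only [herr, hXn, min_self]
    refine this.trans ?_
    have : 22 * δ^2 * KK z * (1 + |z|)^3 ≤ 22 * δ^2 * KK z * (8 * (1 + z ^4)) := 
          mul_le_mul_of_nonneg_left (hpow _) (by positivity)
    have e : 22 * δ^2 * KK z * (8 * (1 + z ^4)) = 176 * δ^2 * K * (1 + z ^ 4) := by rw [hKdef]; ring
    linarith
  have b3 : ∀ j : ℕ, |err (n + 1 + j)| ≤ δ^2 := by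
    intro j
    have hj : (0:ℝ) ≤ j := Nat.cast_nonneg j
    have := S.err_right hh hl (x := X (n + 1 + j)) (R := R) (d := n) 
      (by simp only [hX]; push_cast; rw [← hzn]; nlinarith [mul_nonneg hδ.le hj]) hR hn.le (by rw [← hzn]; ring)
    simp only [herr]
    rw [min_eq_right (by push_cast; linarith)]
    exact this
  have hKP : K * P ≤ 3420 := by
    rw [hKdef]; unfold KK
    have : 1 / z * P ≤ 18 := by
      rw [one_div_mul_eq_div, div_le_iff₀ hz]; exact hPz
    nlinarith
  have hKP0 : 0 ≤ K * P := by positivity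
  have bsum : ∀ M : ℕ, |∑ k ∈ Finset.range (n + 1 + M), π k * err k| ≤ 3900000 * δ^2 := by
    intro M
    refine (Finset.abs_sum_le_sum_abs _ _).trans ?_
    rw [Finset.sum_range_add, Finset.sum_range_succ]
    have habs : ∀ k, |π k * err k| = π k * |err k| := fun k => by
      rw [abs_mul, abs_of_nonneg (E.nonneg k)]
    simp only [habs]
    have s1 : ∑ k ∈ Finset.range n, π k * |err k| ≤
        176 * δ^2 * K * ∑ k ∈ Finset.range n, π k * (1 + X k ^4) := by
      rw [Finset.mul_sum]
      apply Finset.sum_le_sum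
      intro k hk
      have := mul_le_mul_of_nonneg_left (b1 k (Finset.mem_range.1 hk)) (E.nonneg k)
      linarith
    have s2 := mul_le_mul_of_nonneg_left b2 (E.nonneg n)
    have s3 : ∑ j ∈ Finset.range M, π (n + 1 + j) * |err (n + 1 + j)| ≤
        δ^2 * ∑ j ∈ Finset.range M, π (n + 1 + j) := by
      rw [Finset.mul_sum]
      apply Finset.sum_le_sum
      intro j hj
      have := mul_le_mul_of_nonneg_left (b3 j) (E.nonneg (n + 1 + j))
      linarith
    have s4 : π n + ∑ j ∈ Finset.range M, π (n + 1 + j) ≤ 1 := by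
      have := E.sum_le_one (Finset.range (n + 1 + M))
      rw [Finset.sum_range_add, Finset.sum_range_succ] at this
      have : 0 ≤ ∑ k ∈ Finset.range n, π k := Finset.sum_nonneg (fun k _ => E.nonneg k)
      linarith
    have s5 := mul_le_mul_of_nonneg_left s4 (by positivity : 0 ≤ δ^2)
    have s6 := mul_le_mul_of_nonneg_left hmom (by positivity : 0 ≤ 176 * δ^2 * K)
    have s7 := mul_le_mul_of_nonneg_left hπn (by positivity : 0 ≤ δ * K)
    have s8 := mul_le_mul_of_nonneg_left hKP (by positivity : 0 ≤ δ^2)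
    have s9 : 0 < δ^2 := by positivity
    nlinarith
  -- limit
  have hpart : ∀ M : ℕ, ∑ k ∈ Finset.range (n + 1 + M), π k * H (X k) =
      ∑ k ∈ Finset.range (n + 1 + M), π k * err k
        + δ * (n * π (n + 1 + M) * G (X (n + 1 + M) - δ / 2)) := by
    intro M
    have := E.tele (fun k => G (X k - δ/2)) (n + 1 + M)
    rw [min_eq_right (by push_cast; linarith [(Nat.cast_nonneg M : (0:ℝ) ≤ M)])] at this
    rw [← this, Finset.mul_sum, ← Finset.sum_add_distrib]
    apply Finset.sum_congr rfl
    intro k _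
    have e : X (k + 1) - δ / 2 = X k + δ / 2 := by simp only [hX]; push_cast; ring
    simp only [herr]
    rw [e]; ring
  have hGr : ∀ x, z ≤ x → |G x| ≤ |G z| + 1 / z * (x - z) := by
    intro x hx
    have := lip_of (s := z) (t := x) (B := 1 / z) S.G_cont (fun y _ => S.ode y)
      (fun y hy => S.G1R_abs (by rw [min_eq_left hx] at hy; exact hy.1.le))
    rw [abs_of_nonneg (by linarith : 0 ≤ x - z)] at this
    have h2 := abs_sub_abs_le_abs_sub (G x) (G z)
    linarith
  have hbd : Tendsto (fun M : ℕ => δ * (n * π (n + 1 + M) * G (X (n + 1 + M) - δ / 2))) atTop (𝓝 0) := by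
    set ρ := R / n with hρ
    have hρ0 : 0 ≤ ρ := by positivity
    have hρ1 : ρ < 1 := by rw [hρ, div_lt_one hn]; exact hRn
    have t1 := tendsto_pow_atTop_nhds_zero_of_lt_one hρ0 hρ1
    have t2 := tendsto_self_mul_const_pow_of_lt_one hρ0 hρ1
    have lim : Tendsto (fun M : ℕ => δ * n * π n * ρ * ((|G z| + 1 / z * (δ / 2)) * ρ^M
        + (1 / z * δ) * (M * ρ^M))) atTop (𝓝 0) := by
      have := ((t1.const_mul (|G z| + 1 / z * (δ / 2))).add (t2.const_mul (1 / z * δ))).const_mul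
        (δ * n * π n * ρ)
      simpa using this
    apply squeeze_zero_norm _ lim
    intro M
    have hM : (0:ℝ) ≤ M := Nat.cast_nonneg M
    have e : X (n + 1 + M) - δ / 2 = z + δ * (M + 1 / 2) := by
      simp only [hX]; push_cast; rw [← hzn]; ring
    have hg := hGr (z + δ * (M + 1 / 2)) (by nlinarith [mul_nonneg hδ.le hM])
    rw [e, add_assoc n 1 M, E.geom, Real.norm_eq_abs, abs_mul, abs_mul, abs_of_pos hδ,
      abs_of_nonneg (by have := E.nonneg n; positivity : 0 ≤ (n:ℝ) * (π n * (R / n)^(1 + M)))]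
    have := E.nonneg n
    calc _ ≤ δ * (n * (π n * (R / n)^(1 + M)) * (|G z| + 1 / z * (z + δ * (M + 1 / 2) - z))) := by
          gcongr
      _ = _ := by rw [← hρ]; ring
  have hlim : Tendsto (fun M : ℕ => ∑ k ∈ Finset.range (n + 1 + M), π k * H (X k)) atTop
      (𝓝 (∑' k : ℕ, π k * H (X k))) := by
    have := hs.hasSum.tendsto_sum_nat
    have h2 : Tendsto (fun M : ℕ => n + 1 + M) atTop atTop := tendsto_atTop_mono (fun M => Nat.le_add_left M (n + 1)) tendsto_id
    exact this.comp h2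
  have hlim2 := (hlim.sub hbd).abs
  rw [sub_zero] at hlim2
  have : |∑' k : ℕ, π k * H (X k)| ≤ 3900000 * δ^2 := by
    apply le_of_tendsto hlim2
    filter_upwards with M
    rw [hpart M, add_sub_cancel_right]
    exact bsum M
  nlinarith [pow_pos hδ 2]


lemma steinSol_exists {δ z c0 : ℝ} (hδ : 0 < δ) (hδ1 : δ ≤ 1) (hz : 0 < z) (hc0 : 0 < c0)
    {nu h : ℝ → ℝ} (hnu : ∀ x, nu x = c0 / aF δ z x * Real.exp (∫ y in (0:ℝ)..x, 2 * bF z y / aF δ z y))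
    (hnu1 : ∫ x, nu x = 1) (hlip : ∀ x y, |h x - h y| ≤ |x - y|) (hc : Continuous h)
    (hi : Integrable fun x => h x * nu x) :
    ∃ G p : ℝ → ℝ, SteinSol δ z G (fun x => h x - ∫ y, h y * nu y) p := by
  set c := ∫ y, h y * nu y with hcdef
  have hq : Continuous fun y => 2 * bF z y / aF δ z y :=
    (continuous_const.mul (bF_cont z)).div (aF_cont δ z) (fun x => by linarith [aF_ge δ z x])
  set p : ℝ → ℝ := fun x => Real.exp (∫ y in (0:ℝ)..x, 2 * bF z y / aF δ z y) with hp
  have pder : ∀ x, HasDerivAt p (2 * bF z x / aF δ z x * p x) x := by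
    intro x
    have := (hq.integral_hasStrictDerivAt 0 x).hasDerivAt.exp
    rw [mul_comm]
    exact this
  have ppos : ∀ x, 0 < p x := fun x => Real.exp_pos _
  have pcont : Continuous p := continuous_iff_continuousAt.2 fun x => (pder x).continuousAt
  have hnu' : nu = fun x => c0 / aF δ z x * p x := funext hnu
  have nucont : Continuous nu := by
    rw [hnu']
    exact (continuous_const.div (aF_cont δ z) (fun x => by linarith [aF_ge δ z x])).mul pcont
  have nuint : Integrable nu := by
    by_contra hn
    rw [integral_undef hn] at hnu1
    norm_num at hnu1
  set f : ℝ → ℝ := fun x => (h x - c) * nu x with hf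
  have fint : Integrable f := by
    have : f = fun x => h x * nu x - c * nu x := by funext x; simp only [hf]; ring
    rw [this]; exact hi.sub (nuint.const_mul c)
  have fcont : Continuous f := (hc.sub continuous_const).mul nucont
  have fzero : ∫ x, f x = 0 := by
    have : f = fun x => h x * nu x - c * nu x := by funext x; simp only [hf]; ring
    rw [this, integral_sub hi (nuint.const_mul c), integral_const_mul, hnu1, ← hcdef]; ring
  set F : ℝ → ℝ := fun x => (∫ y in Iic (0:ℝ), f y) + ∫ y in (0:ℝ)..x, f y with hF
  have Fder : ∀ x, HasDerivAt F (f x) x := fun x =>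
    (fcont.integral_hasStrictDerivAt 0 x).hasDerivAt.const_add _
  have hGp : ∀ x, 2 / c0 * F x / p x * p x = 2 / c0 * F x := fun x =>
    div_mul_cancel₀ _ (ppos x).ne'
  refine ⟨fun x => 2 / c0 * F x / p x, p, ⟨hδ, hδ1, hz, ?_, ?_, ppos, pder, ?_, ?_⟩⟩
  · intro x y
    have : h x - c - (h y - c) = h x - h y := by ring
    show |h x - c - (h y - c)| ≤ _
    rw [this]; exact hlip x y
  · intro x
    have ha : aF δ z x ≠ 0 := by have := aF_ge δ z x; positivity
    have hpx := (ppos x).ne'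
    have := ((Fder x).const_mul (2 / c0)).div (pder x) hpx
    refine this.congr_deriv ?_
    have hfx : f x = (h x - c) * (c0 / aF δ z x * p x) := by simp only [hf]; rw [hnu]
    rw [hfx]
    field_simp
  · simp only [hGp]
    have h1 := intervalIntegral_tendsto_integral_Iic (μ := volume) (f := f) (0:ℝ) fint.integrableOn tendsto_id
    have h2 : Tendsto F atBot (𝓝 0) := by
      have e : F = fun x => (∫ y in Iic (0:ℝ), f y) - ∫ y in x..(0:ℝ), f y := by
        funext x; simp only [hF]; rw [intervalIntegral.integral_symm x 0]; ring
      rw [e]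
      have := h1.const_sub (∫ y in Iic (0:ℝ), f y)
      rw [sub_self] at this
      exact this
    simpa using h2.const_mul (2 / c0)
  · simp only [hGp]
    have h1 := intervalIntegral_tendsto_integral_Ioi (μ := volume) (f := f) (0:ℝ) fint.integrableOn tendsto_id
    have h2 : Tendsto F atTop (𝓝 0) := by
      have := h1.const_add (∫ y in Iic (0:ℝ), f y)
      rw [intervalIntegral.integral_Iic_add_Ioi fint.integrableOn fint.integrableOn, fzero] at this
      exact this
    simpa using h2.const_mul (2 / c0)

end Helpers


/-- Erlang-C with state-dependent diffusion coefficient: there is a universal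
constant `C > 0` such that the `W₂` distance between the scaled stationary
customer count and the state-dependent diffusion approximation is at most
`C / R`, for all parameters with `1 ≤ R < n`. -/
theorem erlangC_state_dependent_W2 :
    ∃ C : ℝ, 0 < C ∧
      ∀ (lam mu : ℝ) (n : ℕ), 0 < lam → 0 < mu → 1 ≤ n →
      ∀ R δ ζ : ℝ,
        R = lam / mu → 1 ≤ R → R < (n : ℝ) →
        δ = 1 / Real.sqrt R → ζ = δ * (R - (n : ℝ)) →
      ∀ pi : ℕ → ℝ,
        (∀ k, 0 ≤ pi k) → (∑' k : ℕ, pi k) = 1 →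
        (∀ k : ℕ, lam * pi k = mu * min ((k : ℝ) + 1) (n : ℝ) * pi (k + 1)) →
      ∀ b : ℝ → ℝ,
        (∀ x : ℝ, b x = if x ≤ -ζ then -(mu * x) else mu * ζ) →
      ∀ a : ℝ → ℝ,
        (∀ x : ℝ, a x = if x ≤ -(1 / δ) then mu
                        else if x ≤ -ζ then mu * (2 + δ * x)
                        else mu * (2 + δ * |ζ|)) →
      ∀ kappa : ℝ, 0 < kappa →
      ∀ nuS : ℝ → ℝ,
        (∀ x : ℝ, nuS x = (kappa / a x) * Real.exp (∫ y in (0:ℝ)..x, 2 * b y / a y)) →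
        (∫ x : ℝ, nuS x) = 1 →
      ∀ h : ℝ → ℝ,
        Differentiable ℝ h → LipschitzWith 1 h → LipschitzWith 1 (deriv h) →
        (Summable fun k : ℕ => pi k * h (δ * ((k : ℝ) - R))) →
        (Integrable fun x : ℝ => h x * nuS x) →
        |(∑' k : ℕ, pi k * h (δ * ((k : ℝ) - R))) - (∫ x : ℝ, h x * nuS x)|
          ≤ C / R := by
  refine ⟨4000000, by norm_num, ?_⟩
  intro lam mu n hlam hmu hn R δ ζ hR hR1 hRn hδ hζ pi hpi htot hbal b hb a ha kappa hkappa nuS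
    hnu hnu1 h hd hL hL1 hsum hInt
  have hRp : 0 < R := by linarith
  have hs : 1 ≤ Real.sqrt R := Real.one_le_sqrt.2 hR1
  have hs0 : 0 < Real.sqrt R := by linarith
  have hδ0 : 0 < δ := by rw [hδ]; positivity
  have hδ1 : δ ≤ 1 := by rw [hδ, div_le_one hs0]; exact hs
  have hδ2 : δ^2 = 1 / R := by rw [hδ, div_pow, Real.sq_sqrt hRp.le, one_pow]
  obtain ⟨z, hz⟩ : ∃ z, z = -ζ := ⟨_, rfl⟩
  have hzn : z = δ * (n - R) := by rw [hz, hζ]; ring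
  have hz0 : 0 < z := by rw [hzn]; exact mul_pos hδ0 (by linarith)
  have hζz : ζ = -z := by linarith
  have hsm : Summable pi := by
    by_contra hc
    rw [tsum_eq_zero_of_not_summable hc] at htot
    norm_num at htot
  have E : ErlangPi R δ z n pi := by
    refine ⟨hδ0, hδ1, ?_, hzn, hz0, hpi, hsm, htot, ?_⟩
    · rw [hδ2]; field_simp
    · intro k
      have := hbal k
      rw [hR]
      field_simp
      linarith
  have hbF : ∀ x, b x = mu * bF z x := by
    intro x
    rw [hb, ← hz]
    split_ifs with hx
    · rw [bF_left hx]; ring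
    · rw [bF_right (not_le.1 hx).le, hζz]
  have haF : ∀ x, a x = mu * aF δ z x := by
    intro x
    rw [ha, ← hz, hζz, abs_neg, abs_of_pos hz0]
    have hδi : 0 < 1 / δ := by positivity
    split_ifs with h1 h2
    · have h3 : min x z = x := min_eq_left (by linarith)
      have h4 : δ * x ≤ -1 := by
        have := mul_le_mul_of_nonneg_left h1 hδ0.le
        have e : δ * -(1 / δ) = -1 := by field_simp
        linarith
      rw [aF, h3, max_eq_left (by linarith)]; ring
    · rw [aF_mid hδ0 (not_le.1 h1).le h2]
    · have h3 : min x z = z := min_eq_right (not_le.1 h2).le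
      have := mul_pos hδ0 hz0
      rw [aF, h3, max_eq_right (by linarith)]; ring
  have hnu' : ∀ x, nuS x = kappa / mu / aF δ z x *
      Real.exp (∫ y in (0:ℝ)..x, 2 * bF z y / aF δ z y) := by
    intro x
    have e : (fun y => 2 * b y / a y) = fun y => 2 * bF z y / aF δ z y := by
      funext y
      have : aF δ z y ≠ 0 := by have := aF_ge δ z y; positivity
      rw [hbF, haF]
      field_simp
    rw [hnu, e, haF, div_div]
  have hlip : ∀ x y, |h x - h y| ≤ |x - y| := by
    intro x y
    have := hL.dist_le_mul x y
    simpa [Real.dist_eq] using this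
  have hlip1 : ∀ x y, |deriv h x - deriv h y| ≤ |x - y| := by
    intro x y
    have := hL1.dist_le_mul x y
    simpa [Real.dist_eq] using this
  have hder : ∀ x, |deriv h x| ≤ 1 := by
    intro x
    have := norm_deriv_le_of_lipschitz (x₀ := x) hL
    simpa using this
  obtain ⟨G, p, S⟩ := steinSol_exists hδ0 hδ1 hz0 (div_pos hkappa hmu) hnu' hnu1 hlip
    hd.continuous hInt
  set c := ∫ y, h y * nuS y with hc
  have hcs : Summable fun k : ℕ => pi k * c := hsm.mul_right c
  have e1 : (fun k : ℕ => pi k * (h (δ * ((k:ℝ) - R)) - c)) =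
      fun k : ℕ => pi k * h (δ * ((k:ℝ) - R)) - pi k * c := by
    funext k; ring
  have main := discrete_main E S (h1 := deriv h)
    (fun x => (hd x).hasDerivAt.sub_const c) hder hlip1 (by
      simp only [e1]; exact hsum.sub hcs)
  have e2 : ∑' k : ℕ, pi k * (h (δ * ((k:ℝ) - R)) - c) =
      (∑' k : ℕ, pi k * h (δ * ((k:ℝ) - R))) - c := by
    rw [e1, hsum.tsum_sub hcs, tsum_mul_right, htot, one_mul]
  simp only [e2] at main
  rw [hδ2] at main
  calc _ ≤ _ := main
    _ = _ := by ring
end
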